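/- arXiv:2512.10075 — 5 statements merged into one kernel-verified Lean document; each statement's English description precedes it below -/
import Mathlib

section
/- Let ψ : ℝ → ℝ be a bijective, continuously differentiable function with ψ'(x) > 0 for all x and with measurable inverse, let μ be a probability measure on ℝ, and set ν = ψ_*μ. Suppose ν satisfies the Poincaré inequality with constant λ > 0: for every continuously differentiable g : ℝ → ℝ (with g, g², and (g')² ν-integrable), Var_ν(g) ≤ (1/λ) ∫ (g'(y))² dν(y). Then μ satisfies the ψ-Poincaré inequality with the same constant: for every continuously differentiable f : ℝ → ℝ (with f, f², and (f'/ψ')² μ-integrable), Var_μ(f) ≤ (1/λ) ∫ (f'(x)/ψ'(x))² dμ(x). -/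
open MeasureTheory Real
open scoped ENNReal NNReal

/-- The variance functional `Var_μ(f) = ∫ f² dμ − (∫ f dμ)²`. -/
noncomputable def varFun {α : Type*} [MeasurableSpace α] (μ : Measure α)
    (f : α → ℝ) : ℝ :=
  (∫ x, (f x) ^ 2 ∂μ) - (∫ x, f x ∂μ) ^ 2

/-- A surjective `C¹` function on `ℝ` with positive derivative is a homeomorphism with `C¹`
inverse. -/
theorem exists_homeomorph_contDiff_symm_of_deriv_pos {ψ : ℝ → ℝ} (hsurj : Function.Surjective ψ)
    (hC1 : ContDiff ℝ 1 ψ) (hpos : ∀ x, 0 < deriv ψ x) :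
    ∃ e : ℝ ≃ₜ ℝ, ⇑e = ψ ∧ ContDiff ℝ 1 e.symm := by
  refine ⟨((strictMono_of_deriv_pos hpos).orderIsoOfSurjective ψ hsurj).toHomeomorph, rfl, ?_⟩
  refine Homeomorph.contDiff_symm_deriv (f' := deriv ψ) _ (fun x => (hpos x).ne') (fun x => ?_) hC1
  exact ((hC1.differentiable one_ne_zero) x).hasDerivAt

/-- **The `ψ`-Poincaré inequality transfers from the pushforward.**
Let `ψ : ℝ → ℝ` be a bijective `C¹` function with everywhere positive derivative and
measurable inverse, `μ` a probability measure on `ℝ` and `ν = ψ⁎μ`. If `ν` satisfies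
the Poincaré inequality with constant `λ > 0`, then `μ` satisfies the `ψ`-Poincaré
inequality with the same constant, the `ψ`-gradient of `f` being `f'/ψ'`. -/
theorem psi_poincare_transfer
    (ψ : ℝ → ℝ) (hψbij : Function.Bijective ψ) (hψC1 : ContDiff ℝ 1 ψ)
    (hψ' : ∀ x, 0 < deriv ψ x) (hψinv : Measurable (Function.invFun ψ))
    (μ : Measure ℝ) [IsProbabilityMeasure μ]
    (lam : ℝ) (hlam : 0 < lam)
    (hPI : ∀ g : ℝ → ℝ, ContDiff ℝ 1 g →
      Integrable g (μ.map ψ) →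
      Integrable (fun y => (g y) ^ 2) (μ.map ψ) →
      Integrable (fun y => (deriv g y) ^ 2) (μ.map ψ) →
      varFun (μ.map ψ) g ≤ (1 / lam) * ∫ y, (deriv g y) ^ 2 ∂(μ.map ψ)) :
    ∀ f : ℝ → ℝ, ContDiff ℝ 1 f →
      Integrable f μ →
      Integrable (fun x => (f x) ^ 2) μ →
      Integrable (fun x => (deriv f x / deriv ψ x) ^ 2) μ →
      varFun μ f ≤ (1 / lam) * ∫ x, (deriv f x / deriv ψ x) ^ 2 ∂μ := by
  intro f hf hf_int hf_sq hf_grad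
  obtain ⟨e, he, he_symm⟩ :=
    exists_homeomorph_contDiff_symm_of_deriv_pos hψbij.surjective hψC1 hψ'
  have hemb : MeasurableEmbedding ψ := he ▸ e.measurableEmbedding
  set g : ℝ → ℝ := f ∘ e.symm with hg_def
  have hg : ContDiff ℝ 1 g := hf.comp he_symm
  have hg_comp : ∀ x, g (ψ x) = f x := fun x => by simp [hg_def, ← he]
  have hg_deriv : ∀ x, deriv g (ψ x) = deriv f x / deriv ψ x := fun x => by
    have hchain : deriv (g ∘ ψ) x = deriv g (ψ x) * deriv ψ x :=
      deriv_comp x (hg.differentiable one_ne_zero _) (hψC1.differentiable one_ne_zero _)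
    rw [show g ∘ ψ = f from funext hg_comp] at hchain
    rw [hchain, mul_div_cancel_right₀ _ (hψ' x).ne']
  have key := hPI g hg
  simp only [varFun, hemb.integrable_map_iff, hemb.integral_map, Function.comp_def, hg_comp,
    hg_deriv] at key
  exact key hf_int hf_sq hf_grad
end

section
/- Let E be a measurable space, ψ : E ≃ ℝ a measurable equivalence, and μ a probability measure on E whose pushforward ψ_*μ is the standard Gaussian measure N(0,1) on ℝ. Then for every measurable set A ⊆ E with μ(A) ≥ 1/2 and every ε > 0: μ(A_ε^ψ) ≥ Φ(ε), where A_ε^ψ = {x ∈ E : ∃ a ∈ A, |ψ(x) − ψ(a)| < ε} and Φ(ε) = N(0,1)((−∞, ε]) is the standard Gaussian cumulative distribution function. -/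
open MeasureTheory ProbabilityTheory
open scoped ENNReal NNReal

lemma gaussianPDFReal_neg_mean (a x : ℝ) :
    gaussianPDFReal (-a) 1 x = Real.exp (-(a * x) - a ^ 2 / 2) * gaussianPDFReal 0 1 x := by
  simp only [gaussianPDFReal]
  rw [mul_left_comm, ← Real.exp_add]
  congr 2
  push_cast
  ring

lemma gaussianReal_real_eq_setIntegral (m : ℝ) {G : Set ℝ} (hG : MeasurableSet G) :
    (gaussianReal m 1).real G = ∫ x in G, gaussianPDFReal m 1 x := by
  rw [measureReal_def, gaussianReal_apply_eq_integral m one_ne_zero G,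
    ENNReal.toReal_ofReal (setIntegral_nonneg hG fun x _ ↦ gaussianPDFReal_nonneg m 1 x)]

lemma gaussianReal_neg_mean_real_le {a s : ℝ} (ha : 0 ≤ a) {G : Set ℝ} (hG : MeasurableSet G)
    (hs : G ⊆ Set.Ici s) :
    (gaussianReal (-a) 1).real G
      ≤ Real.exp (-(a * s) - a ^ 2 / 2) * (gaussianReal 0 1).real G := by
  rw [gaussianReal_real_eq_setIntegral _ hG, gaussianReal_real_eq_setIntegral _ hG,
    ← integral_const_mul]
  refine setIntegral_mono_on (integrable_gaussianPDFReal _ _).integrableOn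
    ((integrable_gaussianPDFReal _ _).integrableOn.const_mul _) hG fun x hx ↦ ?_
  rw [gaussianPDFReal_neg_mean]
  have := gaussianPDFReal_nonneg 0 1 x
  have hsx : s ≤ x := hs hx
  gcongr

lemma le_gaussianReal_neg_mean_real {a s : ℝ} (ha : 0 ≤ a) {G : Set ℝ} (hG : MeasurableSet G)
    (hs : G ⊆ Set.Iic s) :
    Real.exp (-(a * s) - a ^ 2 / 2) * (gaussianReal 0 1).real G
      ≤ (gaussianReal (-a) 1).real G := by
  rw [gaussianReal_real_eq_setIntegral _ hG, gaussianReal_real_eq_setIntegral _ hG,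
    ← integral_const_mul]
  refine setIntegral_mono_on ((integrable_gaussianPDFReal _ _).integrableOn.const_mul _)
    (integrable_gaussianPDFReal _ _).integrableOn hG fun x hx ↦ ?_
  rw [gaussianPDFReal_neg_mean]
  have := gaussianPDFReal_nonneg 0 1 x
  have hsx : x ≤ s := hs hx
  gcongr

lemma gaussianReal_neg_mean_real (a : ℝ) {G : Set ℝ} (hG : MeasurableSet G) :
    (gaussianReal (-a) 1).real G = (gaussianReal 0 1).real ((fun x ↦ x + -a) ⁻¹' G) := by
  rw [← map_measureReal_apply (by fun_prop) hG, gaussianReal_map_add_const, zero_add]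

lemma gaussianReal_real_neg_preimage {G : Set ℝ} (hG : MeasurableSet G) :
    (gaussianReal 0 1).real ((fun x ↦ -x) ⁻¹' G) = (gaussianReal 0 1).real G := by
  rw [← map_measureReal_apply (by fun_prop) hG, gaussianReal_map_neg, neg_zero]

lemma gaussianReal_real_Ici (x : ℝ) :
    (gaussianReal 0 1).real (Set.Ici x) = (gaussianReal 0 1).real (Set.Ioi x) := by
  have := nullSingletonClass_gaussianReal (μ := 0) (v := 1) one_ne_zero
  exact measureReal_congr Ioi_ae_eq_Ici.symm

lemma gaussianReal_real_Ici_zero : (gaussianReal 0 1).real (Set.Ici 0) = 1 / 2 := by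
  have h := gaussianReal_real_neg_preimage (measurableSet_Ici (a := (0 : ℝ)))
  have e : (fun x : ℝ ↦ -x) ⁻¹' Set.Ici 0 = (Set.Ioi 0)ᶜ := by ext x; simp
  rw [e, probReal_compl_eq_one_sub measurableSet_Ioi, ← gaussianReal_real_Ici] at h
  linarith

lemma gaussianReal_real_Ico_add_Ici {x y : ℝ} (h : x ≤ y) :
    (gaussianReal 0 1).real (Set.Ico x y) + (gaussianReal 0 1).real (Set.Ici y)
      = (gaussianReal 0 1).real (Set.Ici x) := by
  rw [← measureReal_union _ measurableSet_Ici, Set.Ico_union_Ici_eq_Ici h]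
  exact Set.disjoint_left.2 fun z hz hz' ↦ absurd hz.2 (not_lt.2 hz')

lemma gaussianReal_real_Iic (x : ℝ) :
    (gaussianReal 0 1).real (Set.Iic x) = 1 - (gaussianReal 0 1).real (Set.Ici x) := by
  rw [gaussianReal_real_Ici, ← probReal_compl_eq_one_sub measurableSet_Ioi, Set.compl_Ioi]

/-- Log-concavity of the Gaussian tail. -/
lemma gaussianReal_real_Ici_add_le {a s : ℝ} (ha : 0 ≤ a) (hs : 0 ≤ s) :
    (gaussianReal 0 1).real (Set.Ici (s + a))
      ≤ 2 * (gaussianReal 0 1).real (Set.Ici a) * (gaussianReal 0 1).real (Set.Ici s) := by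
  have h1 := gaussianReal_neg_mean_real_le ha measurableSet_Ici (subset_refl (Set.Ici s))
  have h2 := le_gaussianReal_neg_mean_real ha measurableSet_Ico
    (Set.Ico_subset_Iio_self.trans Set.Iio_subset_Iic_self : Set.Ico 0 s ⊆ Set.Iic s)
  rw [gaussianReal_neg_mean_real a measurableSet_Ici] at h1
  rw [gaussianReal_neg_mean_real a measurableSet_Ico] at h2
  have e1 : (fun x ↦ x + -a) ⁻¹' Set.Ici s = Set.Ici (s + a) := by
    ext x; simp [← sub_eq_add_neg]
  have e2 : (fun x ↦ x + -a) ⁻¹' Set.Ico 0 s = Set.Ico a (s + a) := by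
    ext x; simp [← sub_eq_add_neg]
  rw [e1] at h1
  rw [e2] at h2
  have h3 := gaussianReal_real_Ico_add_Ici hs
  have h4 := gaussianReal_real_Ico_add_Ici (show a ≤ s + a by linarith)
  rw [gaussianReal_real_Ici_zero] at h3
  have n1 : 0 ≤ (gaussianReal 0 1).real (Set.Ico 0 s) := measureReal_nonneg
  have n2 : 0 ≤ (gaussianReal 0 1).real (Set.Ici s) := measureReal_nonneg
  have h5 := mul_le_mul_of_nonneg_right h1 n1
  have h6 := mul_le_mul_of_nonneg_right h2 n2
  have h7 : (gaussianReal 0 1).real (Set.Ici (s + a))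
      = 2 * ((gaussianReal 0 1).real (Set.Ici (s + a)) * ((gaussianReal 0 1).real (Set.Ico 0 s)
        + (gaussianReal 0 1).real (Set.Ici s))) := by
    rw [h3]; ring
  rw [← h4]
  linarith

lemma gaussianReal_real_Ici_le_half {a : ℝ} (ha : 0 ≤ a) :
    (gaussianReal 0 1).real (Set.Ici a) ≤ 1 / 2 := by
  rw [← gaussianReal_real_Ici_zero]
  exact measureReal_mono (Set.Ici_subset_Ici.2 ha)

lemma gaussianReal_real_le_thickening_inter_Ioi {ε : ℝ} (hε : 0 < ε) {D : Set ℝ}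
    (hD : MeasurableSet D) (hs : D ⊆ Set.Ici ε) :
    (gaussianReal 0 1).real D ≤ 2 * (gaussianReal 0 1).real (Set.Ici ε) *
      (gaussianReal 0 1).real (Metric.thickening ε D ∩ Set.Ioi 0) := by
  rcases D.eq_empty_or_nonempty with rfl | hne
  · simp
  have hbdd : BddBelow D := ⟨ε, fun x hx ↦ hs hx⟩
  set d := sInf D
  have hd : ε ≤ d := le_csInf hne hs
  have hDd : D ⊆ Set.Ici d := fun x hx ↦ csInf_le hbdd hx
  have hsub : Set.Ioo (d - ε) d ∪ D ⊆ Metric.thickening ε D ∩ Set.Ioi 0 := by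
    rintro x (hx | hx)
    · refine ⟨?_, by have := hx.1; simp only [Set.mem_Ioi]; linarith⟩
      obtain ⟨y, hy, hyx⟩ := exists_lt_of_csInf_lt hne (show d < x + ε by linarith [hx.1])
      refine Metric.mem_thickening_iff.2 ⟨y, hy, ?_⟩
      have : d ≤ y := hDd hy
      rw [Real.dist_eq, abs_lt]
      constructor <;> linarith [hx.2]
    · exact ⟨Metric.self_subset_thickening hε D hx, hε.trans_le (hs hx)⟩
  have hdisj : Disjoint (Set.Ioo (d - ε) d) D :=
    Set.disjoint_left.2 fun x hx hx' ↦ absurd hx.2 (not_lt.2 (hDd hx'))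
  have h1 := measureReal_mono (μ := gaussianReal 0 1) hsub
  rw [measureReal_union hdisj hD] at h1
  have := nullSingletonClass_gaussianReal (μ := 0) (v := 1) one_ne_zero
  have h2 := gaussianReal_real_Ico_add_Ici (show d - ε ≤ d by linarith)
  rw [← measureReal_congr (Ioo_ae_eq_Ico (μ := gaussianReal 0 1) (a := d - ε) (b := d))] at h2
  have h3 := gaussianReal_real_Ici_add_le hε.le (show 0 ≤ d - ε by linarith)
  rw [sub_add_cancel] at h3
  have h4 := measureReal_mono (μ := gaussianReal 0 1) hDd
  have h5 := gaussianReal_real_Ici_le_half hε.le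
  have h6 : 0 ≤ (gaussianReal 0 1).real (Set.Ici ε) := measureReal_nonneg
  nlinarith

lemma thickening_neg_preimage (ε : ℝ) (D : Set ℝ) :
    Metric.thickening ε ((fun x ↦ -x) ⁻¹' D) = (fun x ↦ -x) ⁻¹' Metric.thickening ε D := by
  ext x
  simp only [Metric.mem_thickening_iff, Set.mem_preimage]
  constructor
  · rintro ⟨z, hz, h⟩
    exact ⟨-z, hz, by rwa [dist_neg_neg]⟩
  · rintro ⟨z, hz, h⟩
    exact ⟨-z, by rwa [neg_neg], by rwa [← dist_neg_neg, neg_neg]⟩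

lemma gaussianReal_real_le_thickening {ε : ℝ} (hε : 0 < ε) {D : Set ℝ}
    (hD : MeasurableSet D) (hs : ∀ x ∈ D, ε ≤ |x|) :
    (gaussianReal 0 1).real D ≤ 2 * (gaussianReal 0 1).real (Set.Ici ε) *
      (gaussianReal 0 1).real (Metric.thickening ε D) := by
  have hN : MeasurableSet ((fun x : ℝ ↦ -x) ⁻¹' D) := measurable_neg hD
  have h1 := gaussianReal_real_le_thickening_inter_Ioi hε (hD.inter measurableSet_Ici)
    (Set.inter_subset_right (s := D) (t := Set.Ici ε))
  have h2 := gaussianReal_real_le_thickening_inter_Ioi hε (hN.inter measurableSet_Ici)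
    (Set.inter_subset_right (t := Set.Ici ε))
  have hU : MeasurableSet (Metric.thickening ε D) := Metric.isOpen_thickening.measurableSet
  have m1 := measureReal_mono (μ := gaussianReal 0 1) (Set.inter_subset_inter_left (Set.Ioi 0)
    (Metric.thickening_subset_of_subset ε (Set.inter_subset_left (s := D) (t := Set.Ici ε))))
  have m2 := measureReal_mono (μ := gaussianReal 0 1) (Set.inter_subset_inter_left (Set.Ioi 0)
    (Metric.thickening_subset_of_subset ε
      (Set.inter_subset_left (s := (fun x : ℝ ↦ -x) ⁻¹' D) (t := Set.Ici ε))))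
  have e1 : (fun x : ℝ ↦ -x) ⁻¹' D ∩ Set.Ici ε = (fun x ↦ -x) ⁻¹' (D ∩ Set.Iic (-ε)) := by
    ext x; simp
  have e2 : (fun x : ℝ ↦ -x) ⁻¹' Metric.thickening ε D ∩ Set.Ioi 0
      = (fun x ↦ -x) ⁻¹' (Metric.thickening ε D ∩ Set.Iio 0) := by
    ext x; simp
  rw [thickening_neg_preimage, e2,
    gaussianReal_real_neg_preimage (hU.inter measurableSet_Iio)] at m2
  have e3 : (gaussianReal 0 1).real ((fun x : ℝ ↦ -x) ⁻¹' D ∩ Set.Ici ε)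
      = (gaussianReal 0 1).real (D ∩ Set.Iic (-ε)) := by
    rw [e1, gaussianReal_real_neg_preimage (hD.inter measurableSet_Iic)]
  rw [e3] at h2
  have h3 : (gaussianReal 0 1).real D
      ≤ (gaussianReal 0 1).real (D ∩ Set.Ici ε) + (gaussianReal 0 1).real (D ∩ Set.Iic (-ε)) := by
    refine (measureReal_mono fun x hx ↦ ?_).trans (measureReal_union_le _ _)
    rcases le_abs.1 (hs x hx) with h | h
    · exact Or.inl ⟨hx, h⟩
    · exact Or.inr ⟨hx, by simp only [Set.mem_Iic]; linarith⟩
  have h4 : (gaussianReal 0 1).real (Metric.thickening ε D ∩ Set.Ioi 0)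
      + (gaussianReal 0 1).real (Metric.thickening ε D ∩ Set.Iio 0)
      ≤ (gaussianReal 0 1).real (Metric.thickening ε D) := by
    rw [← measureReal_union _ (hU.inter measurableSet_Iio)]
    · exact measureReal_mono (Set.union_subset Set.inter_subset_left Set.inter_subset_left)
    · exact Set.disjoint_left.2 fun x hx hx' ↦ lt_asymm (Set.mem_Ioi.1 hx.2) hx'.2
  have h6 : 0 ≤ 2 * (gaussianReal 0 1).real (Set.Ici ε) := by positivity
  have h7 := mul_le_mul_of_nonneg_left m1 h6
  have h8 := mul_le_mul_of_nonneg_left m2 h6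
  have h9 := mul_le_mul_of_nonneg_left h4 h6
  linarith

lemma gaussianReal_real_Ico_le_Ioo {a ε : ℝ} (ha : 0 ≤ a) (haε : a ≤ ε) :
    (gaussianReal 0 1).real (Set.Ico 0 ε) ≤ (gaussianReal 0 1).real (Set.Ioo (-a) (ε - a)) := by
  have := nullSingletonClass_gaussianReal (μ := 0) (v := 1) one_ne_zero
  have h1 := gaussianReal_neg_mean_real_le (sub_nonneg.2 haε) measurableSet_Ico
    (Set.Ico_subset_Ici_self : Set.Ico 0 a ⊆ _)
  have e1 : (fun x ↦ x + -(ε - a)) ⁻¹' Set.Ico 0 a = Set.Ico (ε - a) ε := by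
    ext x
    simp only [Set.mem_preimage, Set.mem_Ico]
    constructor <;> rintro ⟨h, h'⟩ <;> constructor <;> linarith
  rw [gaussianReal_neg_mean_real _ measurableSet_Ico, e1] at h1
  have h2 : Real.exp (-((ε - a) * 0) - (ε - a) ^ 2 / 2) ≤ 1 := by
    rw [Real.exp_le_one_iff]
    nlinarith [sq_nonneg (ε - a)]
  have e2 : (fun x : ℝ ↦ -x) ⁻¹' Set.Ico 0 a = Set.Ioc (-a) 0 := by
    ext x
    simp only [Set.mem_preimage, Set.mem_Ico, Set.mem_Ioc]
    constructor <;> rintro ⟨h, h'⟩ <;> constructor <;> linarith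
  have h3 := gaussianReal_real_neg_preimage (measurableSet_Ico (a := 0) (b := a))
  rw [e2, measureReal_congr (Ioo_ae_eq_Ioc (μ := gaussianReal 0 1)).symm] at h3
  have h4 : (gaussianReal 0 1).real (Set.Ioo (-a) 0) + (gaussianReal 0 1).real (Set.Ico 0 (ε - a))
      = (gaussianReal 0 1).real (Set.Ioo (-a) (ε - a)) := by
    rw [← measureReal_union _ measurableSet_Ico]
    · rcases ha.eq_or_lt with rfl | ha'
      · simpa using (measureReal_congr (Ioo_ae_eq_Ico (μ := gaussianReal 0 1))).symm
      · rw [Set.Ioo_union_Ico_eq_Ioo (by linarith) (by linarith)]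
    · exact Set.disjoint_left.2 fun x hx hx' ↦ absurd hx.2 (not_lt.2 hx'.1)
  have h5 : (gaussianReal 0 1).real (Set.Ico 0 (ε - a))
      + (gaussianReal 0 1).real (Set.Ico (ε - a) ε) = (gaussianReal 0 1).real (Set.Ico 0 ε) := by
    rw [← measureReal_union _ measurableSet_Ico, Set.Ico_union_Ico_eq_Ico (by linarith) (by linarith)]
    exact Set.disjoint_left.2 fun x hx hx' ↦ absurd hx.2 (not_lt.2 hx'.1)
  have h6 := mul_le_mul_of_nonneg_right h2
    (measureReal_nonneg (μ := gaussianReal 0 1) (s := Set.Ico 0 a))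
  linarith

lemma gaussianReal_real_Iic_le_thickening_of_lt {ε : ℝ} (hε : 0 < ε) {B : Set ℝ}
    (hB : MeasurableSet B) (hhalf : 1 / 2 ≤ (gaussianReal 0 1).real B) {b c : ℝ} (hb : b ∈ B)
    (hbε : -ε < b) (hc : c ∉ Metric.thickening ε B) (hcε : c < ε) (hbc : b < c) :
    (gaussianReal 0 1).real (Set.Iic ε) ≤ (gaussianReal 0 1).real (Metric.thickening ε B) := by
  have hfar : ∀ x ∈ B, ε ≤ |c - x| := fun x hx ↦ by
    by_contra! h
    exact hc (Metric.mem_thickening_iff.2 ⟨x, hx, h⟩)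
  have hne : (B ∩ Set.Iic c).Nonempty := ⟨b, hb, hbc.le⟩
  have hle : ∀ x ∈ B ∩ Set.Iic c, x ≤ c - ε := fun x hx ↦ by
    have := hfar x hx.1
    rw [abs_of_nonneg (sub_nonneg.2 hx.2)] at this
    linarith
  have hbdd : BddAbove (B ∩ Set.Iic c) := ⟨c - ε, hle⟩
  obtain ⟨a, ha⟩ : ∃ a, -a = sSup (B ∩ Set.Iic c) := ⟨_, neg_neg _⟩
  have hac : -a ≤ c - ε := ha ▸ csSup_le hne hle
  have hba : b ≤ -a := ha ▸ le_csSup hbdd ⟨hb, hbc.le⟩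
  have hsub : Set.Ioo (-a) (ε - a) ∪ B ⊆ Metric.thickening ε B := by
    rintro x (hx | hx)
    · obtain ⟨y, hy, hyx⟩ := exists_lt_of_lt_csSup hne
        (show x - ε < sSup (B ∩ Set.Iic c) by rw [← ha]; linarith [hx.2])
      refine Metric.mem_thickening_iff.2 ⟨y, hy.1, ?_⟩
      have : y ≤ -a := ha ▸ le_csSup hbdd hy
      rw [Real.dist_eq, abs_lt]
      constructor <;> linarith [hx.1]
    · exact Metric.self_subset_thickening hε B hx
  have hdisj : Disjoint (Set.Ioo (-a) (ε - a)) B := by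
    refine Set.disjoint_left.2 fun x hx hx' ↦ ?_
    have : x ≤ -a := ha ▸ le_csSup hbdd ⟨hx', by simp only [Set.mem_Iic]; linarith [hx.2]⟩
    linarith [hx.1]
  have h1 := measureReal_mono (μ := gaussianReal 0 1) hsub
  rw [measureReal_union hdisj hB] at h1
  have h2 := gaussianReal_real_Ico_le_Ioo (show 0 ≤ a by linarith) (show a ≤ ε by linarith)
  have h3 := gaussianReal_real_Ico_add_Ici hε.le
  rw [gaussianReal_real_Ici_zero] at h3
  rw [gaussianReal_real_Iic]
  linarith

/-- The Gaussian isoperimetric inequality on the line for sets of measure at least one half. -/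
lemma gaussianReal_real_Iic_le_thickening {ε : ℝ} (hε : 0 < ε) {B : Set ℝ}
    (hB : MeasurableSet B) (hhalf : 1 / 2 ≤ (gaussianReal 0 1).real B) :
    (gaussianReal 0 1).real (Set.Iic ε) ≤ (gaussianReal 0 1).real (Metric.thickening ε B) := by
  have hU : MeasurableSet (Metric.thickening ε B) := Metric.isOpen_thickening.measurableSet
  have hr0 : 0 ≤ (gaussianReal 0 1).real (Set.Ici ε) := measureReal_nonneg
  by_cases hBε : ∀ x ∈ B, ε ≤ |x|
  · have h1 := gaussianReal_real_le_thickening hε hB hBε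
    rw [gaussianReal_real_Iic]
    have hpos : 0 < (gaussianReal 0 1).real (Set.Ici ε) := by
      refine hr0.lt_of_ne fun h ↦ ?_
      rw [← h] at h1
      linarith
    by_contra! h
    have h2 := mul_lt_mul_of_pos_left h hpos
    nlinarith [sq_nonneg (2 * (gaussianReal 0 1).real (Set.Ici ε) - 1)]
  by_cases hCε : ∀ x ∈ (Metric.thickening ε B)ᶜ, ε ≤ |x|
  · have h1 := gaussianReal_real_le_thickening hε hU.compl hCε
    have h2 : (gaussianReal 0 1).real (Metric.thickening ε (Metric.thickening ε B)ᶜ)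
        ≤ (gaussianReal 0 1).real Bᶜ := by
      refine measureReal_mono fun x hx hxB ↦ ?_
      obtain ⟨y, hy, hxy⟩ := Metric.mem_thickening_iff.1 hx
      exact hy (Metric.mem_thickening_iff.2 ⟨x, hxB, by rwa [dist_comm]⟩)
    rw [probReal_compl_eq_one_sub hB] at h2
    rw [probReal_compl_eq_one_sub hU] at h1
    rw [gaussianReal_real_Iic]
    nlinarith
  push Not at hBε hCε
  obtain ⟨b, hb, hbε⟩ := hBε
  obtain ⟨c, hc, hcε⟩ := hCε
  rw [abs_lt] at hbε hcε
  rcases lt_trichotomy b c with h | rfl | h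
  · exact gaussianReal_real_Iic_le_thickening_of_lt hε hB hhalf hb hbε.1 hc hcε.2 h
  · exact absurd (Metric.self_subset_thickening hε B hb) hc
  · rw [← gaussianReal_real_neg_preimage hU, ← thickening_neg_preimage]
    refine gaussianReal_real_Iic_le_thickening_of_lt hε (measurable_neg hB)
      (by rwa [gaussianReal_real_neg_preimage hB]) (b := -b) (c := -c)
      (by simpa using hb) (by linarith) ?_ (by linarith) (by linarith)
    rw [thickening_neg_preimage]
    simpa only [Set.mem_preimage, neg_neg, Set.mem_compl_iff] using hc

/-- **Transported Gaussian isoperimetric inequality.**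
If `ψ : E ≃ᵐ ℝ` is a measurable equivalence and `μ` is a probability measure on `E`
with `ψ⁎μ = N(0,1)`, then for every measurable `A ⊆ E` with `μ(A) ≥ 1/2` and every
`ε > 0`, the `ψ`-enlargement satisfies `μ(A_ε^ψ) ≥ Φ(ε)`, where `Φ` is the standard
Gaussian CDF. -/
theorem transported_gaussian_isoperimetry
    {E : Type*} [MeasurableSpace E] (ψ : E ≃ᵐ ℝ)
    (μ : Measure E) [IsProbabilityMeasure μ]
    (hgauss : μ.map ψ = gaussianReal 0 1) :
    ∀ A : Set E, MeasurableSet A → (1 : ℝ≥0∞) / 2 ≤ μ A →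
      ∀ ε : ℝ, 0 < ε →
        gaussianReal 0 1 (Set.Iic ε) ≤ μ {x : E | ∃ a ∈ A, |ψ x - ψ a| < ε} := by
  intro A hA hhalf ε hε
  have hB : MeasurableSet (ψ.symm ⁻¹' A) := ψ.symm.measurable hA
  have e1 : μ A = gaussianReal 0 1 (ψ.symm ⁻¹' A) := by
    rw [← hgauss, ψ.map_apply]
    congr 1
    ext x
    simp
  have e2 : μ {x : E | ∃ a ∈ A, |ψ x - ψ a| < ε}
      = gaussianReal 0 1 (Metric.thickening ε (ψ.symm ⁻¹' A)) := by
    rw [← hgauss, ψ.map_apply]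
    congr 1
    ext x
    simp only [Set.mem_ofPred_eq, Set.mem_preimage, Metric.mem_thickening_iff, Real.dist_eq]
    constructor
    · rintro ⟨a, ha, h⟩
      exact ⟨ψ a, by simpa using ha, h⟩
    · rintro ⟨z, hz, h⟩
      exact ⟨ψ.symm z, hz, by simpa using h⟩
  rw [e2]
  rw [e1] at hhalf
  refine (ENNReal.toReal_le_toReal (measure_ne_top _ _) (measure_ne_top _ _)).1 ?_
  refine gaussianReal_real_Iic_le_thickening hε hB ?_
  simpa [measureReal_def] using ENNReal.toReal_mono (measure_ne_top _ _) hhalf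
end

section
/- Let E be a measurable space, ψ : E ≃ ℝ a measurable equivalence, and μ a probability measure on E with ψ_*μ = N(0,1). For every c ∈ ℝ, the ψ-half-space H_c = {x ∈ E : ψ(x) ≤ c} is isoperimetrically optimal: its ψ-perimeter satisfies μ^{+,ψ}(H_c) = (2π)^{−1/2} e^{−c²/2}, and the ψ-isoperimetric profile of μ at v = Φ(c) equals this value, i.e. inf{μ^{+,ψ}(A) : A measurable, μ(A) = Φ(c)} = (2π)^{−1/2} e^{−c²/2}, where Φ(c) = N(0,1)((−∞, c]). -/
open MeasureTheory ProbabilityTheory Filter Real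
open scoped ENNReal NNReal Topology

/-- The `ψ`-perimeter (Minkowski content) of `A` with respect to `μ`:
`μ^{+,ψ}(A) = liminf_{ε→0⁺} (μ(A_ε^ψ) − μ(A))/ε`, where
`A_ε^ψ = {x : ∃ a ∈ A, |ψ x − ψ a| < ε}`. -/
noncomputable def psiPerimeter {E : Type*} [MeasurableSpace E]
    (μ : Measure E) (ψ : E → ℝ) (A : Set E) : ℝ≥0∞ :=
  Filter.liminf
    (fun ε : ℝ => (μ {x : E | ∃ a ∈ A, |ψ x - ψ a| < ε} - μ A) / ENNReal.ofReal ε)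
    (𝓝[>] (0 : ℝ))

section GaussianLine

open Set

/-- The density of the standard Gaussian measure on `ℝ`. -/
noncomputable def gaussDensity (x : ℝ) : ℝ := Real.exp (-x ^ 2 / 2) / Real.sqrt (2 * Real.pi)

/-- The distribution function of the standard Gaussian measure on `ℝ`. -/
noncomputable def gaussCDF (x : ℝ) : ℝ := (gaussianReal 0 1).real (Iic x)

instance nullSingletonClass_gaussianReal_zero_one :
    NullSingletonClass (gaussianReal 0 1) :=
  nullSingletonClass_gaussianReal one_ne_zero

lemma gaussDensity_pos (x : ℝ) : 0 < gaussDensity x := by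
  unfold gaussDensity; positivity

lemma gaussDensity_eq_gaussianPDFReal (x : ℝ) : gaussDensity x = gaussianPDFReal 0 1 x := by
  simp [gaussDensity, gaussianPDFReal, div_eq_inv_mul]

lemma gaussDensity_neg (x : ℝ) : gaussDensity (-x) = gaussDensity x := by
  simp [gaussDensity]

lemma hasDerivAt_gaussDensity (x : ℝ) : HasDerivAt gaussDensity (-x * gaussDensity x) x := by
  have h : HasDerivAt (fun y : ℝ => -y ^ 2 / 2) (-x) x := by
    exact ((hasDerivAt_pow 2 x).neg.div_const 2).congr_deriv (by norm_num; ring)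
  exact (h.exp.div_const (Real.sqrt (2 * Real.pi))).congr_deriv (by rw [gaussDensity]; ring)

lemma continuous_gaussDensity : Continuous gaussDensity := by
  unfold gaussDensity; fun_prop

lemma tendsto_gaussDensity_atBot : Tendsto gaussDensity atBot (𝓝 0) := by
  have h : Tendsto (fun x : ℝ => x ^ 2 / 2) atBot atTop :=
    ((tendsto_pow_atTop two_ne_zero).comp tendsto_abs_atBot_atTop).congr
      (fun x => by simp) |>.atTop_div_const two_pos
  have := (Real.tendsto_exp_neg_atTop_nhds_zero.comp h).div_const (Real.sqrt (2 * Real.pi))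
  simp only [zero_div] at this
  refine this.congr fun x => ?_
  simp [gaussDensity, neg_div]

lemma integrable_gaussDensity : Integrable gaussDensity := by
  rw [funext gaussDensity_eq_gaussianPDFReal]
  exact integrable_gaussianPDFReal 0 1

lemma gaussCDF_eq_integral (x : ℝ) : gaussCDF x = ∫ t in Iic x, gaussDensity t := by
  rw [gaussCDF, measureReal_def, gaussianReal_apply_eq_integral 0 one_ne_zero,
    ENNReal.toReal_ofReal (integral_nonneg fun t => gaussianPDFReal_nonneg 0 1 t)]
  simp_rw [gaussDensity_eq_gaussianPDFReal]

lemma gaussCDF_sub (a b : ℝ) : gaussCDF b - gaussCDF a = ∫ t in a..b, gaussDensity t := by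
  rw [gaussCDF_eq_integral, gaussCDF_eq_integral]
  exact intervalIntegral.integral_Iic_sub_Iic integrable_gaussDensity.integrableOn
    integrable_gaussDensity.integrableOn

lemma hasDerivAt_gaussCDF (x : ℝ) : HasDerivAt gaussCDF (gaussDensity x) x := by
  have h := (continuous_gaussDensity.integral_hasStrictDerivAt 0 x).hasDerivAt.add_const (gaussCDF 0)
  refine h.congr_of_eventuallyEq (.of_forall fun y => ?_)
  simp [← gaussCDF_sub]

lemma continuous_gaussCDF : Continuous gaussCDF :=
  continuous_iff_continuousAt.2 fun x => (hasDerivAt_gaussCDF x).continuousAt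

lemma strictMono_gaussCDF : StrictMono gaussCDF :=
  strictMono_of_hasDerivAt_pos hasDerivAt_gaussCDF gaussDensity_pos

lemma tendsto_gaussCDF_atBot : Tendsto gaussCDF atBot (𝓝 0) :=
  (tendsto_cdf_atBot (gaussianReal 0 1)).congr fun x => cdf_eq_real _ x

lemma tendsto_gaussCDF_atTop : Tendsto gaussCDF atTop (𝓝 1) :=
  (tendsto_cdf_atTop (gaussianReal 0 1)).congr fun x => cdf_eq_real _ x

lemma gaussCDF_pos (x : ℝ) : 0 < gaussCDF x :=
  measureReal_nonneg.trans_lt (strictMono_gaussCDF (sub_one_lt x))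

lemma gaussianReal_real_Iio (x : ℝ) : (gaussianReal 0 1).real (Iio x) = gaussCDF x :=
  measureReal_congr Iio_ae_eq_Iic

lemma gaussianReal_real_Ioi (x : ℝ) : (gaussianReal 0 1).real (Ioi x) = 1 - gaussCDF x := by
  rw [← compl_Iic, probReal_compl_eq_one_sub measurableSet_Iic, gaussCDF]

lemma gaussCDF_neg (x : ℝ) : gaussCDF (-x) = 1 - gaussCDF x := by
  have h : (gaussianReal 0 1).map (fun y : ℝ => -y) = gaussianReal 0 1 := by
    simpa using gaussianReal_map_neg (μ := 0) (v := 1)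
  rw [← gaussianReal_real_Ioi, gaussCDF]
  conv_lhs => rw [← h]
  rw [map_measureReal_apply measurable_neg measurableSet_Iic, measureReal_congr Ioi_ae_eq_Ici]
  congr 1
  ext y
  simp

lemma gaussianReal_real_Ioo {a b : ℝ} (h : a ≤ b) :
    (gaussianReal 0 1).real (Ioo a b) = gaussCDF b - gaussCDF a := by
  rw [measureReal_congr Ioo_ae_eq_Ioc, ← Iic_sdiff_Iic,
    measureReal_sdiff (Iic_subset_Iic.2 h) measurableSet_Iic, gaussCDF, gaussCDF]

lemma gaussCDF_lt_one (x : ℝ) : gaussCDF x < 1 := by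
  linarith [gaussCDF_pos (-x), gaussCDF_neg x]

lemma exists_gaussCDF_eq {p : ℝ} (h0 : 0 < p) (h1 : p < 1) : ∃ x, gaussCDF x = p :=
  mem_range_of_exists_le_of_exists_ge continuous_gaussCDF
    ((tendsto_gaussCDF_atBot.eventually_le_const h0).exists)
    ((tendsto_gaussCDF_atTop.eventually_const_le h1).exists)

lemma hasDerivAt_gaussDensity_add_mul_gaussCDF (s x : ℝ) :
    HasDerivAt (fun y => gaussDensity y + s * gaussCDF y) ((s - x) * gaussDensity x) x := by
  exact ((hasDerivAt_gaussDensity x).add ((hasDerivAt_gaussCDF x).const_mul s)).congr_deriv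
    (by ring)

lemma neg_mul_gaussCDF_le (b : ℝ) : -b * gaussCDF b ≤ gaussDensity b := by
  have hmono : MonotoneOn (fun y => gaussDensity y + b * gaussCDF y) (Iic b) := by
    refine monotoneOn_of_hasDerivWithinAt_nonneg (convex_Iic b)
      (fun x _ => (hasDerivAt_gaussDensity_add_mul_gaussCDF b x).continuousAt.continuousWithinAt)
      (fun x _ => (hasDerivAt_gaussDensity_add_mul_gaussCDF b x).hasDerivWithinAt) fun x hx => ?_
    rw [interior_Iic] at hx
    exact mul_nonneg (sub_nonneg.2 (le_of_lt hx)) (gaussDensity_pos x).le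
  have hlim : Tendsto (fun y => gaussDensity y + b * gaussCDF y) atBot (𝓝 0) := by
    simpa using tendsto_gaussDensity_atBot.add (tendsto_gaussCDF_atBot.const_mul b)
  have : 0 ≤ gaussDensity b + b * gaussCDF b :=
    le_of_tendsto hlim ((eventually_le_atBot b).mono fun y hy => hmono hy self_mem_Iic hy)
  linarith

lemma gaussDensity_sub_le {a c : ℝ} (h : a ≤ c) :
    gaussDensity c - gaussDensity a ≤ -a * (gaussCDF c - gaussCDF a) := by
  have hanti : AntitoneOn (fun y => gaussDensity y + a * gaussCDF y) (Ici a) := by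
    refine antitoneOn_of_hasDerivWithinAt_nonpos (convex_Ici a)
      (fun x _ => (hasDerivAt_gaussDensity_add_mul_gaussCDF a x).continuousAt.continuousWithinAt)
      (fun x _ => (hasDerivAt_gaussDensity_add_mul_gaussCDF a x).hasDerivWithinAt) fun x hx => ?_
    rw [interior_Ici] at hx
    exact mul_nonpos_of_nonpos_of_nonneg (sub_nonpos.2 (le_of_lt hx)) (gaussDensity_pos x).le
  have := hanti self_mem_Ici h h
  simp only at this
  linarith

/-- The Gaussian isoperimetric function `gaussDensity ∘ gaussCDF⁻¹` is subadditive. -/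
lemma gaussDensity_le_add {a b c : ℝ} (h : gaussCDF a + gaussCDF b = gaussCDF c) :
    gaussDensity c ≤ gaussDensity a + gaussDensity b := by
  wlog hba : b ≤ a generalizing a b
  · rw [add_comm]
    exact this (by linarith) (le_of_not_ge hba)
  have hac : a ≤ c := strictMono_gaussCDF.le_iff_le.1 (by linarith [gaussCDF_pos b])
  have h1 := gaussDensity_sub_le hac
  have h2 := neg_mul_gaussCDF_le b
  have h3 : gaussCDF c - gaussCDF a = gaussCDF b := by linarith
  rw [h3] at h1
  have h4 := mul_le_mul_of_nonneg_right (neg_le_neg hba) (gaussCDF_pos b).le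
  linarith

/-- The ratio `gaussDensity / gaussCDF` is antitone. -/
lemma antitone_gaussDensity_div_gaussCDF :
    Antitone (fun x => gaussDensity x / gaussCDF x) := by
  have hd (x : ℝ) := (hasDerivAt_gaussDensity x).div (hasDerivAt_gaussCDF x) (gaussCDF_pos x).ne'
  refine antitone_of_deriv_nonpos (fun x => (hd x).differentiableAt) fun x => ?_
  refine (hd x).deriv.le.trans (div_nonpos_of_nonpos_of_nonneg ?_ (sq_nonneg _))
  have := mul_le_mul_of_nonneg_left (neg_mul_gaussCDF_le x) (gaussDensity_pos x).le
  linarith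

/-- A bounded interval whose Gaussian mass is at most `gaussCDF d` has a ratio of perimeter to mass
at least that of the half-line `Iio d`. -/
lemma gaussDensity_div_gaussCDF_mul_sub_le {a b d : ℝ} (hab : a < b)
    (h : gaussCDF b - gaussCDF a ≤ gaussCDF d) :
    gaussDensity d / gaussCDF d * (gaussCDF b - gaussCDF a) ≤ gaussDensity a + gaussDensity b := by
  obtain ⟨e, he⟩ := exists_gaussCDF_eq (sub_pos.2 (strictMono_gaussCDF hab))
    (h.trans_lt (gaussCDF_lt_one d))
  have hsub : gaussDensity (-e) ≤ gaussDensity a + gaussDensity (-b) :=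
    gaussDensity_le_add (by rw [gaussCDF_neg, gaussCDF_neg]; linarith)
  rw [gaussDensity_neg, gaussDensity_neg] at hsub
  rw [← he] at h ⊢
  refine le_trans ?_ hsub
  rw [← le_div_iff₀ (gaussCDF_pos e)]
  exact antitone_gaussDensity_div_gaussCDF (strictMono_gaussCDF.le_iff_le.1 h)

lemma tendsto_gaussCDF_add_sub_div (a : ℝ) :
    Tendsto (fun ε => (gaussCDF (a + ε) - gaussCDF a) / ε) (𝓝[>] 0) (𝓝 (gaussDensity a)) :=
  (hasDerivAt_gaussCDF a).tendsto_slope_zero_right.congr fun ε => by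
    rw [smul_eq_mul, div_eq_inv_mul]

lemma tendsto_gaussCDF_sub_sub_div (b : ℝ) :
    Tendsto (fun ε => (gaussCDF b - gaussCDF (b - ε)) / ε) (𝓝[>] 0) (𝓝 (gaussDensity b)) := by
  have h := tendsto_gaussCDF_add_sub_div (-b)
  rw [gaussDensity_neg] at h
  refine h.congr fun ε => ?_
  rw [show -b + ε = -(b - ε) by ring, gaussCDF_neg, gaussCDF_neg]
  ring

/-- The connected components of the complement of a nonempty closed subset of `ℝ`. -/
lemma connectedComponentIn_compl_eq_interval {C : Set ℝ} (hC : IsClosed C) (hne : C.Nonempty)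
    {x : ℝ} (hx : x ∉ C) :
    (∃ a ∈ C, ∃ b ∈ C, a < b ∧ connectedComponentIn Cᶜ x = Ioo a b) ∨
      (∃ b ∈ C, connectedComponentIn Cᶜ x = Iio b) ∨
      ∃ a ∈ C, connectedComponentIn Cᶜ x = Ioi a := by
  set J := connectedComponentIn Cᶜ x with hJ
  have hJord : J.OrdConnected := isPreconnected_connectedComponentIn.ordConnected
  have hxJ : x ∈ J := mem_connectedComponentIn hx
  have hJC (y : ℝ) (hy : y ∈ J) : y ∉ C := connectedComponentIn_subset Cᶜ x hy
  have hmax (S : Set ℝ) (hS : S.OrdConnected) (hxS : x ∈ S) (hSC : ∀ y ∈ S, y ∉ C) : S ⊆ J :=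
    hS.isPreconnected.subset_connectedComponentIn hxS hSC
  have hright (b : ℝ) (hb : b ∈ C) (hxb : x < b) (y : ℝ) (hy : y ∈ J) : y < b := by
    by_contra! hby
    exact hJC b (hJord.out hxJ hy ⟨hxb.le, hby⟩) hb
  have hleft (a : ℝ) (ha : a ∈ C) (hax : a < x) (y : ℝ) (hy : y ∈ J) : a < y := by
    by_contra! hya
    exact hJC a (hJord.out hy hxJ ⟨hya, hax.le⟩) ha
  have hexr (h : (C ∩ Ici x).Nonempty) : ∃ b ∈ C, x < b ∧ ∀ y ∈ C, x ≤ y → b ≤ y := by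
    have hbdd : BddBelow (C ∩ Ici x) := ⟨x, fun y hy => hy.2⟩
    have hmem := (hC.inter isClosed_Ici).csInf_mem h hbdd
    exact ⟨_, hmem.1, lt_of_le_of_ne hmem.2 (ne_of_mem_of_not_mem hmem.1 hx).symm,
      fun y hy hxy => csInf_le hbdd ⟨hy, hxy⟩⟩
  have hexl (h : (C ∩ Iic x).Nonempty) : ∃ a ∈ C, a < x ∧ ∀ y ∈ C, y ≤ x → y ≤ a := by
    have hbdd : BddAbove (C ∩ Iic x) := ⟨x, fun y hy => hy.2⟩
    have hmem := (hC.inter isClosed_Iic).csSup_mem h hbdd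
    exact ⟨_, hmem.1, lt_of_le_of_ne hmem.2 (ne_of_mem_of_not_mem hmem.1 hx),
      fun y hy hxy => le_csSup hbdd ⟨hy, hxy⟩⟩
  by_cases hr : (C ∩ Ici x).Nonempty
  · obtain ⟨b, hb, hxb, hbmin⟩ := hexr hr
    by_cases hl : (C ∩ Iic x).Nonempty
    · obtain ⟨a, ha, hax, hamax⟩ := hexl hl
      refine .inl ⟨a, ha, b, hb, hax.trans hxb, Subset.antisymm
        (fun y hy => ⟨hleft a ha hax y hy, hright b hb hxb y hy⟩)
        (hmax _ ordConnected_Ioo ⟨hax, hxb⟩ fun y hy hyC => ?_)⟩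
      rcases le_total x y with h | h
      · exact (hbmin y hyC h).not_gt hy.2
      · exact (hamax y hyC h).not_gt hy.1
    · refine .inr (.inl ⟨b, hb, Subset.antisymm (fun y hy => hright b hb hxb y hy)
        (hmax _ ordConnected_Iio hxb fun y hy hyC => ?_)⟩)
      rcases le_total x y with h | h
      · exact (hbmin y hyC h).not_gt hy
      · exact hl ⟨y, hyC, h⟩
  · have hl : (C ∩ Iic x).Nonempty := by
      obtain ⟨y, hy⟩ := hne
      exact ⟨y, hy, (le_total y x).resolve_right fun h => hr ⟨y, hy, h⟩⟩
    obtain ⟨a, ha, hax, hamax⟩ := hexl hl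
    refine .inr (.inr ⟨a, ha, Subset.antisymm (fun y hy => hleft a ha hax y hy)
      (hmax _ ordConnected_Ioi hax fun y hy hyC => ?_)⟩)
    rcases le_total x y with h | h
    · exact hr ⟨y, hyC, h⟩
    · exact (hamax y hyC h).not_gt hy

lemma Ioo_add_subset_thickening {C : Set ℝ} {a : ℝ} (ha : a ∈ C) (ε : ℝ) :
    Ioo a (a + ε) ⊆ Metric.thickening ε C := fun y hy => by
  refine Metric.mem_thickening_iff.2 ⟨a, ha, ?_⟩
  rw [Real.dist_eq, abs_lt]
  constructor <;> linarith [hy.1, hy.2]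

lemma Ioo_sub_subset_thickening {C : Set ℝ} {b : ℝ} (hb : b ∈ C) (ε : ℝ) :
    Ioo (b - ε) b ⊆ Metric.thickening ε C := fun y hy => by
  refine Metric.mem_thickening_iff.2 ⟨b, hb, ?_⟩
  rw [Real.dist_eq, abs_lt]
  constructor <;> linarith [hy.1, hy.2]

/-- Each complementary interval of a closed set `C` contributes to the perimeter of `C` at least
its mass times the ratio of perimeter to mass of the half-line `Iio d`. -/
lemma eventually_le_measureReal_connectedComponentIn_inter_thickening {C : Set ℝ}
    (hC : IsClosed C) (hne : C.Nonempty) {x d s : ℝ} (hx : x ∉ C)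
    (hd : (gaussianReal 0 1).real (connectedComponentIn Cᶜ x) ≤ gaussCDF d)
    (hs : s < gaussDensity d / gaussCDF d *
      (gaussianReal 0 1).real (connectedComponentIn Cᶜ x)) :
    ∀ᶠ ε in 𝓝[>] (0 : ℝ), s * ε ≤
      (gaussianReal 0 1).real (connectedComponentIn Cᶜ x ∩ Metric.thickening ε C) := by
  have hratio {b : ℝ} (hb : gaussCDF b ≤ gaussCDF d) :
      gaussDensity d / gaussCDF d * gaussCDF b ≤ gaussDensity b := by
    rw [← le_div_iff₀ (gaussCDF_pos b)]
    exact antitone_gaussDensity_div_gaussCDF (strictMono_gaussCDF.le_iff_le.1 hb)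
  rcases connectedComponentIn_compl_eq_interval hC hne hx with
    ⟨a, ha, b, hb, hab, hJ⟩ | ⟨b, hb, hJ⟩ | ⟨a, ha, hJ⟩
  · rw [hJ, gaussianReal_real_Ioo hab.le] at hd hs
    have hlim := (tendsto_gaussCDF_add_sub_div a).add (tendsto_gaussCDF_sub_sub_div b)
    have hev := hlim.eventually_const_lt (hs.trans_le (gaussDensity_div_gaussCDF_mul_sub_le hab hd))
    filter_upwards [hev, self_mem_nhdsWithin,
      Ioo_mem_nhdsGT (show (0 : ℝ) < (b - a) / 2 by linarith)] with ε h hε hεab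
    have hε0 : 0 < ε := hε
    have hεab := hεab.2
    rw [← add_div, lt_div_iff₀ hε0] at h
    have hdisj : Disjoint (Ioo a (a + ε)) (Ioo (b - ε) b) :=
      disjoint_left.2 fun y hy hy' => by linarith [hy.2, hy'.1]
    have hsub : Ioo a (a + ε) ∪ Ioo (b - ε) b ⊆ Ioo a b ∩ Metric.thickening ε C :=
      union_subset
        (subset_inter (Ioo_subset_Ioo_right (by linarith)) (Ioo_add_subset_thickening ha ε))
        (subset_inter (Ioo_subset_Ioo_left (by linarith)) (Ioo_sub_subset_thickening hb ε))
    rw [hJ]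
    refine le_trans ?_ (measureReal_mono hsub)
    rw [measureReal_union hdisj measurableSet_Ioo, gaussianReal_real_Ioo (by linarith),
      gaussianReal_real_Ioo (by linarith)]
    exact h.le
  · rw [hJ, gaussianReal_real_Iio] at hd hs
    have hev := (tendsto_gaussCDF_sub_sub_div b).eventually_const_lt (hs.trans_le (hratio hd))
    filter_upwards [hev, self_mem_nhdsWithin] with ε h hε
    have hε0 : 0 < ε := hε
    rw [lt_div_iff₀ hε0, ← gaussianReal_real_Ioo (by linarith)] at h
    rw [hJ]
    exact h.le.trans (measureReal_mono
      (subset_inter Ioo_subset_Iio_self (Ioo_sub_subset_thickening hb ε)))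
  · rw [hJ, gaussianReal_real_Ioi, ← gaussCDF_neg] at hd hs
    have hlt := hs.trans_le (hratio hd)
    rw [gaussDensity_neg] at hlt
    have hev := (tendsto_gaussCDF_add_sub_div a).eventually_const_lt hlt
    filter_upwards [hev, self_mem_nhdsWithin] with ε h hε
    have hε0 : 0 < ε := hε
    rw [lt_div_iff₀ hε0, ← gaussianReal_real_Ioo (by linarith)] at h
    rw [hJ]
    exact h.le.trans (measureReal_mono
      (subset_inter Ioo_subset_Ioi_self (Ioo_add_subset_thickening ha ε)))

lemma eventually_le_measureReal_thickening_diff {C : Set ℝ} (hC : IsClosed C) (hne : C.Nonempty)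
    {d r : ℝ} (hd : (gaussianReal 0 1).real Cᶜ = gaussCDF d) (hr : r < gaussDensity d) :
    ∀ᶠ ε in 𝓝[>] (0 : ℝ), r * ε ≤ (gaussianReal 0 1).real (Metric.thickening ε C \ C) := by
  wlog hr0 : 0 ≤ r generalizing r
  · filter_upwards [this (gaussDensity_pos d) le_rfl, self_mem_nhdsWithin] with ε _ hε
    exact (mul_nonpos_of_nonpos_of_nonneg (le_of_not_ge hr0) (le_of_lt hε)).trans
      measureReal_nonneg
  set γ := gaussianReal 0 1
  set l := gaussDensity d / gaussCDF d with hl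
  have hl0 : 0 < l := div_pos (gaussDensity_pos d) (gaussCDF_pos d)
  have hrl : r / l < gaussCDF d := by
    rw [div_lt_iff₀ hl0, hl, mul_div_cancel₀ _ (gaussCDF_pos d).ne']
    exact hr
  obtain ⟨K, hKC, hK, hrK⟩ : ∃ K ⊆ Cᶜ, IsCompact K ∧ r / l < γ.real K := by
    rw [← hd, measureReal_def, ← ENNReal.ofReal_lt_iff_lt_toReal (by positivity)
      (measure_ne_top _ _)] at hrl
    obtain ⟨K, hKC, hK, h⟩ := hC.isOpen_compl.exists_lt_isCompact hrl
    exact ⟨K, hKC, hK, (ENNReal.ofReal_lt_iff_lt_toReal (by positivity)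
      (measure_ne_top _ _)).1 h⟩
  obtain ⟨t, htK, hKt⟩ := hK.elim_nhds_subcover (connectedComponentIn Cᶜ) fun x hx =>
    hC.isOpen_compl.connectedComponentIn.mem_nhds (mem_connectedComponentIn (hKC hx))
  classical
  set T : Finset (Set ℝ) := t.image (connectedComponentIn Cᶜ)
  have hT {J : Set ℝ} (hJ : J ∈ T) : ∃ x ∉ C, connectedComponentIn Cᶜ x = J := by
    obtain ⟨x, hx, rfl⟩ := Finset.mem_image.1 hJ
    exact ⟨x, hKC (htK x hx), rfl⟩
  have hopen (J : Set ℝ) (hJ : J ∈ T) : IsOpen J := by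
    obtain ⟨x, -, rfl⟩ := hT hJ
    exact hC.isOpen_compl.connectedComponentIn
  have hdisj : (T : Set (Set ℝ)).PairwiseDisjoint id := by
    intro J hJ J' hJ' hne
    obtain ⟨x, -, rfl⟩ := hT hJ
    obtain ⟨x', -, rfl⟩ := hT hJ'
    refine disjoint_left.2 fun y hy hy' => hne ?_
    rw [connectedComponentIn_eq hy, connectedComponentIn_eq hy']
  have hmass : r / l < ∑ J ∈ T, γ.real J := by
    refine hrK.trans_le ?_
    have hle : γ.real K ≤ γ.real (⋃ J ∈ T, id J) := by
      refine measureReal_mono (hKt.trans ?_) (measure_ne_top _ _)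
      simp [T]
    rwa [measureReal_biUnion_finset hdisj fun J hJ => (hopen J hJ).measurableSet] at hle
  set M := ∑ J ∈ T, γ.real J
  have hM0 : 0 < M := lt_of_le_of_lt (by positivity) hmass
  have hev : ∀ J ∈ T, ∀ᶠ ε in 𝓝[>] (0 : ℝ),
      r / M * γ.real J * ε ≤ γ.real (J ∩ Metric.thickening ε C) := by
    intro J hJ
    obtain ⟨x, hx, rfl⟩ := hT hJ
    refine eventually_le_measureReal_connectedComponentIn_inter_thickening hC hne hx
      (hd ▸ measureReal_mono (connectedComponentIn_subset _ _)) ?_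
    refine mul_lt_mul_of_pos_right ?_ ?_
    · rw [div_lt_iff₀ hM0]
      rwa [div_lt_iff₀' hl0] at hmass
    · refine ENNReal.toReal_pos (ne_of_gt ?_) (measure_ne_top _ _)
      refine pos_iff_ne_zero.2 fun h0 => ?_
      have := gaussianReal_absolutelyContinuous' 0 one_ne_zero h0
      exact ((hopen _ hJ).measure_pos volume ⟨x, mem_connectedComponentIn hx⟩).ne' this
  filter_upwards [(Finset.eventually_all T).2 hev] with ε hε
  have hsub : ⋃ J ∈ T, J ∩ Metric.thickening ε C ⊆ Metric.thickening ε C \ C := by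
    refine iUnion₂_subset fun J hJ y hy => ⟨hy.2, ?_⟩
    obtain ⟨x, -, rfl⟩ := hT hJ
    exact connectedComponentIn_subset _ _ hy.1
  refine le_trans ?_ (measureReal_mono hsub)
  rw [measureReal_biUnion_finset (f := fun J => J ∩ Metric.thickening ε C) (fun J hJ J' hJ' h =>
      (hdisj hJ hJ' h).mono inter_subset_left inter_subset_left)
    fun J hJ => (hopen J hJ).measurableSet.inter Metric.isOpen_thickening.measurableSet]
  calc r * ε = r / M * M * ε := by rw [div_mul_cancel₀ _ hM0.ne']
    _ = ∑ J ∈ T, r / M * γ.real J * ε := by rw [Finset.mul_sum, Finset.sum_mul]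
    _ ≤ _ := Finset.sum_le_sum hε

lemma ofReal_le_div_ofReal_of_mul_le {ν : Measure ℝ} [IsFiniteMeasure ν] {S B : Set ℝ} {r ε : ℝ}
    (hε : 0 < ε) (hr : 0 ≤ r) (h : r * ε ≤ ν.real S - ν.real B) :
    ENNReal.ofReal r ≤ (ν S - ν B) / ENNReal.ofReal ε := by
  rw [ENNReal.le_div_iff_mul_le (.inl (by simpa using hε)) (.inl ENNReal.ofReal_ne_top),
    ← ENNReal.ofReal_mul hr]
  refine (ENNReal.ofReal_le_ofReal h).trans_eq ?_
  rw [ENNReal.ofReal_sub _ measureReal_nonneg, ofReal_measureReal, ofReal_measureReal]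

/-- **Gaussian isoperimetric inequality on the line**, for the Minkowski content. -/
theorem ofReal_gaussDensity_le_liminf {B : Set ℝ} {c : ℝ}
    (hc : gaussianReal 0 1 B = gaussianReal 0 1 (Iic c)) :
    ENNReal.ofReal (gaussDensity c) ≤ liminf
      (fun ε : ℝ => (gaussianReal 0 1 (Metric.thickening ε B) - gaussianReal 0 1 B) /
        ENNReal.ofReal ε) (𝓝[>] (0 : ℝ)) := by
  set γ := gaussianReal 0 1
  have hcB : γ.real B = gaussCDF c := congrArg ENNReal.toReal hc
  have hne : B.Nonempty := by
    by_contra! h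
    rw [h, measureReal_empty] at hcB
    exact (gaussCDF_pos c).ne hcB
  have hev (r : ℝ) (hr : r < gaussDensity c) :
      ∀ᶠ ε in 𝓝[>] (0 : ℝ), r * ε ≤ γ.real (Metric.thickening ε B) - γ.real B := by
    rcases (measureReal_mono (μ := γ) (subset_closure (s := B))).eq_or_lt with h | h
    · have hd : γ.real (closure B)ᶜ = gaussCDF (-c) := by
        rw [probReal_compl_eq_one_sub isClosed_closure.measurableSet, ← h, hcB, gaussCDF_neg]
      have := eventually_le_measureReal_thickening_diff isClosed_closure hne.closure hd
        (r := r) (by rwa [gaussDensity_neg])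
      filter_upwards [this, self_mem_nhdsWithin] with ε hε hε0
      rw [Metric.thickening_closure, measureReal_sdiff
        (Metric.closure_subset_thickening hε0 B) isClosed_closure.measurableSet, ← h] at hε
      exact hε
    · have hlim : Tendsto (fun ε : ℝ => r * ε) (𝓝[>] 0) (𝓝 0) := by
        simpa using (tendsto_id.const_mul r).mono_left (nhdsWithin_le_nhds (a := (0 : ℝ)))
      filter_upwards [hlim.eventually_le_const (sub_pos.2 h), self_mem_nhdsWithin] with ε hε hε0
      exact hε.trans (sub_le_sub_right
        (measureReal_mono (Metric.closure_subset_thickening hε0 B)) _)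
  refine le_of_forall_lt fun q hq => ?_
  obtain ⟨r, hqr, hr⟩ := ENNReal.lt_iff_exists_nnreal_btwn.1 hq
  refine hqr.trans_le (le_liminf_of_le (by isBoundedDefault) ?_)
  rw [ENNReal.lt_ofReal_iff_toReal_lt ENNReal.coe_ne_top] at hr
  filter_upwards [hev r hr, self_mem_nhdsWithin] with ε hε hε0
  simpa using ofReal_le_div_ofReal_of_mul_le hε0 r.2 hε

lemma tendsto_gaussianReal_Iio_sub_Iic_div (c : ℝ) :
    Tendsto (fun ε : ℝ => (gaussianReal 0 1 (Iio (c + ε)) - gaussianReal 0 1 (Iic c)) /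
      ENNReal.ofReal ε) (𝓝[>] (0 : ℝ)) (𝓝 (ENNReal.ofReal (gaussDensity c))) := by
  refine (ENNReal.tendsto_ofReal (tendsto_gaussCDF_add_sub_div c)).congr' ?_
  filter_upwards [self_mem_nhdsWithin] with ε hε
  rw [ENNReal.ofReal_div_of_pos hε, ← gaussianReal_real_Iio, gaussCDF,
    ENNReal.ofReal_sub _ measureReal_nonneg, ofReal_measureReal, ofReal_measureReal]

lemma measure_eq_map_image {E : Type*} [MeasurableSpace E] (ψ : E ≃ᵐ ℝ) (μ : Measure E)
    (A : Set E) : μ A = μ.map ψ (ψ '' A) := by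
  rw [ψ.map_apply, ψ.injective.preimage_image]

lemma psiPerimeter_eq_liminf_thickening {E : Type*} [MeasurableSpace E] (ψ : E ≃ᵐ ℝ)
    (μ : Measure E) (A : Set E) :
    psiPerimeter μ ψ A = liminf
      (fun ε : ℝ => (μ.map ψ (Metric.thickening ε (ψ '' A)) - μ.map ψ (ψ '' A)) /
        ENNReal.ofReal ε) (𝓝[>] (0 : ℝ)) := by
  unfold psiPerimeter
  congr 1
  ext ε
  rw [ψ.map_apply, ψ.map_apply, ψ.injective.preimage_image]
  congr 3
  ext x
  simp [Metric.mem_thickening_iff, Real.dist_eq]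

lemma thickening_Iic {c ε : ℝ} (hε : 0 < ε) : Metric.thickening ε (Iic c) = Iio (c + ε) := by
  ext y
  rw [Metric.mem_thickening_iff]
  constructor
  · rintro ⟨z, hz, hyz⟩
    rw [Real.dist_eq, abs_lt] at hyz
    have : z ≤ c := hz
    exact mem_Iio.2 (by linarith)
  · intro hy
    have : y < c + ε := hy
    refine ⟨min y c, mem_Iic.2 (min_le_right _ _), ?_⟩
    rw [Real.dist_eq, abs_lt]
    rcases min_cases y c with h | h <;> constructor <;> linarith

end GaussianLine

/-- **Optimality of `ψ`-half-spaces for the transported Gaussian measure.**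
If `ψ⁎μ = N(0,1)`, then for every `c ∈ ℝ` the `ψ`-half-space `H_c = {ψ ≤ c}` has
`ψ`-perimeter `(2π)^{−1/2} e^{−c²/2}`, and this value equals the `ψ`-isoperimetric
profile of `μ` at volume `v = Φ(c)`. -/
theorem psi_halfspace_isoperimetric_optimality
    {E : Type*} [MeasurableSpace E] (ψ : E ≃ᵐ ℝ)
    (μ : Measure E) [IsProbabilityMeasure μ]
    (hgauss : μ.map ψ = gaussianReal 0 1) (c : ℝ) :
    psiPerimeter μ ψ {x : E | ψ x ≤ c}
        = ENNReal.ofReal (Real.exp (-c ^ 2 / 2) / Real.sqrt (2 * Real.pi)) ∧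
    (⨅ (A : Set E) (_ : MeasurableSet A) (_ : μ A = gaussianReal 0 1 (Set.Iic c)),
        psiPerimeter μ ψ A)
      = ENNReal.ofReal (Real.exp (-c ^ 2 / 2) / Real.sqrt (2 * Real.pi)) := by
  have himage : ψ '' {x : E | ψ x ≤ c} = Set.Iic c :=
    Set.image_preimage_eq (Set.Iic c) ψ.surjective
  have hhalf : psiPerimeter μ ψ {x : E | ψ x ≤ c} = ENNReal.ofReal (gaussDensity c) := by
    rw [psiPerimeter_eq_liminf_thickening, hgauss, himage]
    refine Tendsto.liminf_eq ((tendsto_gaussianReal_Iio_sub_Iic_div c).congr' ?_)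
    filter_upwards [self_mem_nhdsWithin] with ε hε
    rw [thickening_Iic hε]
  refine ⟨hhalf, le_antisymm ?_ (le_iInf₂ fun A _ => le_iInf fun hAc => ?_)⟩
  · refine (iInf₂_le {x : E | ψ x ≤ c} (ψ.measurable measurableSet_Iic)).trans
      ((iInf_le _ ?_).trans hhalf.le)
    rw [measure_eq_map_image ψ, himage, hgauss]
  · rw [psiPerimeter_eq_liminf_thickening, hgauss]
    refine ofReal_gaussDensity_le_liminf ?_
    rw [← hAc, measure_eq_map_image ψ, hgauss]
end

section
/- Let E be a measurable space, ψ : E ≃ ℝ a measurable equivalence, and μ a probability measure on E with ψ_*μ = N(0,1). Then μ satisfies the ψ-T₂ (Talagrand transportation-cost) inequality: for every probability measure ν on E that is absolutely continuous with respect to μ, inf{∫ |ψ(x) − ψ(y)|² dπ(x,y) : π a coupling of ν and μ} ≤ 2·D(ν‖μ), where D(ν‖μ) is the Kullback–Leibler divergence of ν with respect to μ. -/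
open MeasureTheory ProbabilityTheory
open scoped ENNReal NNReal Classical

/-- The Kullback–Leibler divergence `D(ν‖μ) = ∫ log(dν/dμ) dν` when `ν ≪ μ` and the
log-likelihood ratio is integrable, and `+∞` otherwise. -/

noncomputable def klDiv {E : Type*} [MeasurableSpace E]
    (ν μ : Measure E) : ℝ≥0∞ :=
  if ν ≪ μ ∧ Integrable (fun x => Real.log (ν.rnDeriv μ x).toReal) ν then
    ENNReal.ofReal (∫ x, Real.log (ν.rnDeriv μ x).toReal ∂ν)
  else ⊤

lemma ProbabilityTheory.continuous_cdf (ν : Measure ℝ) [IsProbabilityMeasure ν]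
    [NullSingletonClass ν] : Continuous (cdf ν) := by
  refine continuous_iff_continuousAt.2 fun a => ?_
  have h := (cdf ν).measure_singleton a
  rw [measure_cdf, measure_singleton, eq_comm, ENNReal.ofReal_eq_zero, sub_nonpos] at h
  rw [(cdf ν).mono.continuousAt_iff_leftLim_eq_rightLim, StieltjesFunction.rightLim_eq]
  exact le_antisymm ((cdf ν).mono.leftLim_le le_rfl) h

lemma ProbabilityTheory.strictMono_cdf (γ : Measure ℝ) [IsProbabilityMeasure γ]
    [γ.IsOpenPosMeasure] : StrictMono (cdf γ) := by
  intro a b hab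
  have h := (cdf γ).measure_Ioc a b
  rw [measure_cdf] at h
  have hpos : 0 < γ (Set.Ioc a b) :=
    ((Measure.measure_Ioo_pos γ).2 hab).trans_le (measure_mono Set.Ioo_subset_Ioc_self)
  rw [h, ENNReal.ofReal_pos] at hpos
  linarith

/-- The monotone rearrangement `T` of `γ` onto `ν`: it is the left-continuous inverse of the
distribution function of `ν`, composed with the distribution function of `γ`. -/
lemma exists_monotone_rearrangement (γ ν : Measure ℝ) [IsProbabilityMeasure γ]
    [IsProbabilityMeasure ν] [NullSingletonClass γ] [γ.IsOpenPosMeasure] :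
    ∃ T : ℝ → ℝ, Measurable T ∧ γ.map T = ν ∧
      ∀ x y, T y ≤ x ↔ cdf γ y ≤ cdf ν x := by
  have hmono := strictMono_cdf γ
  have hpos (y : ℝ) : 0 < cdf γ y := (cdf_nonneg γ (y - 1)).trans_lt (hmono (by linarith))
  have hlt (y : ℝ) : cdf γ y < 1 := (hmono (by linarith : y < y + 1)).trans_le (cdf_le_one γ _)
  let S : ℝ → Set ℝ := fun y => {t | cdf γ y ≤ cdf ν t}
  have hSne (y : ℝ) : (S y).Nonempty :=
    (((tendsto_cdf_atTop ν).eventually (lt_mem_nhds (hlt y))).exists).imp fun _ h => h.le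
  have hSbdd (y : ℝ) : BddBelow (S y) := by
    obtain ⟨b, hb⟩ := ((tendsto_cdf_atBot ν).eventually (gt_mem_nhds (hpos y))).exists
    refine ⟨b, fun t ht => ?_⟩
    by_contra! h
    exact absurd (hb.trans_le ht) (not_lt.2 (monotone_cdf ν h.le))
  have hiff (x y : ℝ) : sInf (S y) ≤ x ↔ cdf γ y ≤ cdf ν x := by
    refine ⟨fun h => ?_, fun h => csInf_le (hSbdd y) h⟩
    have hright : Filter.Tendsto (cdf ν) (nhdsWithin x (Set.Ioi x)) (nhds (cdf ν x)) :=
      ((cdf ν).right_continuous x).mono_left (nhdsWithin_mono _ Set.Ioi_subset_Ici_self)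
    refine ge_of_tendsto hright (eventually_mem_nhdsWithin.mono fun z hz => ?_)
    obtain ⟨t, ht, htz⟩ := exists_lt_of_csInf_lt (hSne y) (h.trans_lt hz)
    exact le_trans ht (monotone_cdf ν htz.le)
  have hT : Measurable fun y => sInf (S y) := by
    refine measurable_of_Iic fun x => ?_
    have : (fun y => sInf (S y)) ⁻¹' Set.Iic x = cdf γ ⁻¹' Set.Iic (cdf ν x) := by
      ext y; exact hiff x y
    rw [this]
    exact (monotone_cdf γ).measurable measurableSet_Iic
  refine ⟨fun y => sInf (S y), hT, ?_, hiff⟩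
  have := Measure.isProbabilityMeasure_map (μ := γ) hT.aemeasurable
  refine Measure.ext_of_Iic _ _ fun x => ?_
  rw [Measure.map_apply hT measurableSet_Iic, ← ofReal_cdf ν x]
  have hpre : (fun y => sInf (S y)) ⁻¹' Set.Iic x = {y | cdf γ y ≤ cdf ν x} := by
    ext y; exact hiff x y
  rw [hpre]
  rcases (cdf_nonneg ν x).eq_or_lt with h0 | h0
  · have : {y | cdf γ y ≤ cdf ν x} = ∅ := by
      ext y; simpa [← h0] using hpos y
    rw [this, ← h0]; simp
  rcases (cdf_le_one ν x).eq_or_lt with h1 | h1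
  · have : {y | cdf γ y ≤ cdf ν x} = Set.univ := by
      ext y; simpa [h1] using (hlt y).le
    rw [this, h1]; simp
  obtain ⟨s, hs⟩ : ∃ s, cdf γ s = cdf ν x := by
    obtain ⟨a, ha⟩ := ((tendsto_cdf_atBot γ).eventually (gt_mem_nhds h0)).exists
    obtain ⟨b, hb⟩ := ((tendsto_cdf_atTop γ).eventually (lt_mem_nhds h1)).exists
    exact mem_range_of_exists_le_of_exists_ge (continuous_cdf γ) ⟨a, ha.le⟩ ⟨b, hb.le⟩
  have : {y | cdf γ y ≤ cdf ν x} = Set.Iic s := by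
    ext y; simp [← hs, hmono.le_iff_le]
  rw [this, ← ofReal_cdf γ s, hs]

lemma cdf_monotone_rearrangement {γ ν : Measure ℝ} [IsProbabilityMeasure ν]
    [NullSingletonClass ν] {T : ℝ → ℝ} (hT : ∀ x y, T y ≤ x ↔ cdf γ y ≤ cdf ν x) (y : ℝ) :
    cdf ν (T y) = cdf γ y := by
  refine le_antisymm ?_ ((hT _ _).1 le_rfl)
  have hleft : Filter.Tendsto (cdf ν) (nhdsWithin (T y) (Set.Iio (T y))) (nhds (cdf ν (T y))) :=
    (continuous_cdf ν).continuousAt.mono_left nhdsWithin_le_nhds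
  refine le_of_tendsto hleft (eventually_mem_nhdsWithin.mono fun z hz => ?_)
  by_contra! h
  exact absurd ((hT z y).2 h.le) (not_le.2 hz)

/-- The signed kernel whose integral in `x` is `t`. -/
noncomputable def signedInterval (x t : ℝ) : ℝ :=
  (Set.Ico 0 t).indicator 1 x - (Set.Ico t 0).indicator 1 x

lemma integrable_indicator_Ico_one (a b : ℝ) :
    Integrable (fun x => (Set.Ico a b).indicator (1 : ℝ → ℝ) x) :=
  (integrable_indicator_iff measurableSet_Ico).2 (integrableOn_const (C := (1 : ℝ)) (by simp))

lemma integrable_signedInterval (t : ℝ) : Integrable (fun x => signedInterval x t) :=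
  (integrable_indicator_Ico_one 0 t).sub (integrable_indicator_Ico_one t 0)

lemma integral_signedInterval (t : ℝ) : ∫ x, signedInterval x t = t := by
  unfold signedInterval
  rw [integral_sub (integrable_indicator_Ico_one 0 t) (integrable_indicator_Ico_one t 0),
    integral_indicator_one measurableSet_Ico, integral_indicator_one measurableSet_Ico]
  rcases le_total 0 t with h | h <;> simp [measureReal_def, h]

lemma integral_abs_signedInterval (t : ℝ) : ∫ x, |signedInterval x t| = |t| := by
  rcases le_total 0 t with h | h
  · have : ∀ x, |signedInterval x t| = signedInterval x t := fun x => by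
      simp [signedInterval, h, abs_of_nonneg, Set.indicator_nonneg]
    simp_rw [this, integral_signedInterval, abs_of_nonneg h]
  · have : ∀ x, |signedInterval x t| = - signedInterval x t := fun x => by
      simp [signedInterval, h, abs_of_nonneg, Set.indicator_nonneg]
    simp_rw [this, integral_neg, integral_signedInterval, abs_of_nonpos h]

lemma measurable_signedInterval :
    Measurable (fun p : ℝ × ℝ => signedInterval p.1 p.2) := by
  have h (p : ℝ × ℝ) : signedInterval p.1 p.2 =
      {p : ℝ × ℝ | 0 ≤ p.1 ∧ p.1 < p.2}.indicator (fun _ => (1 : ℝ)) p -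
        {p : ℝ × ℝ | p.2 ≤ p.1 ∧ p.1 < 0}.indicator (fun _ => (1 : ℝ)) p := rfl
  simp_rw [h]
  refine (measurable_const.indicator ?_).sub (measurable_const.indicator ?_)
  · exact (measurableSet_le measurable_const measurable_fst).inter
      (measurableSet_lt measurable_fst measurable_snd)
  · exact (measurableSet_le measurable_snd measurable_fst).inter
      (measurableSet_lt measurable_fst measurable_const)

/-- If `g` is centred, then `∫ y in {T > x}, g y` integrates in `x` to `∫ y, g y * T y`. -/
lemma integrable_setIntegral_lt_and_integral_eq {α : Type*} [MeasurableSpace α] {γ : Measure α}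
    [SFinite γ] {T g : α → ℝ} (hT : Measurable T) (hg : Integrable g γ) (hg0 : ∫ y, g y ∂γ = 0)
    (hgT : Integrable (fun y => g y * T y) γ) :
    Integrable (fun x => ∫ y in {y | x < T y}, g y ∂γ) ∧
      ∫ x, ∫ y in {y | x < T y}, g y ∂γ = ∫ y, g y * T y ∂γ := by
  have hmeas (x : ℝ) : MeasurableSet {y | x < T y} := measurableSet_lt measurable_const hT
  have hK (x : ℝ) : ∫ y, g y * signedInterval x (T y) ∂γ = ∫ y in {y | x < T y}, g y ∂γ := by
    rcases le_or_gt 0 x with hx | hx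
    · rw [← integral_indicator (hmeas x)]
      refine integral_congr_ae (.of_forall fun y => ?_)
      by_cases h : x < T y <;> simp [signedInterval, hx, h, hx.not_gt]
    · have hcompl : ∫ y in {y | x < T y}, g y ∂γ = - ∫ y in {y | x < T y}ᶜ, g y ∂γ := by
        linarith [integral_add_compl (hmeas x) hg]
      rw [hcompl, ← integral_indicator (hmeas x).compl, ← integral_neg]
      refine integral_congr_ae (.of_forall fun y => ?_)
      by_cases h : x < T y <;> simp [signedInterval, hx, h, hx.not_ge, not_le.2, le_of_not_gt]
  have hint : Integrable (Function.uncurry fun x y => g y * signedInterval x (T y))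
      ((volume : Measure ℝ).prod γ) := by
    refine (integrable_prod_iff' ?_).2 ⟨.of_forall fun y => ?_, ?_⟩
    · exact (hg.1.comp_snd).mul (measurable_signedInterval.comp
        (measurable_fst.prodMk (hT.comp measurable_snd))).aestronglyMeasurable
    · exact (integrable_signedInterval (T y)).const_mul (g y)
    · refine hgT.norm.congr (.of_forall fun y => ?_)
      simp [Function.uncurry, integral_const_mul, integral_abs_signedInterval]
  refine ⟨?_, ?_⟩
  · simpa only [Function.uncurry, hK] using hint.integral_prod_left
  · simp_rw [← hK]
    rw [integral_integral_swap hint]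
    simp_rw [integral_const_mul, integral_signedInterval]

lemma integrable_gaussianReal_iff {f : ℝ → ℝ} {m : ℝ} {v : ℝ≥0} (hv : v ≠ 0) :
    Integrable f (gaussianReal m v) ↔ Integrable (fun x => gaussianPDFReal m v x * f x) := by
  rw [gaussianReal_of_var_ne_zero _ hv, integrable_withDensity_iff_integrable_smul'
    (measurable_gaussianPDF _ _) (.of_forall fun _ => gaussianPDF_lt_top)]
  simp

lemma hasDerivAt_gaussianPDFReal_zero_one (x : ℝ) :
    HasDerivAt (gaussianPDFReal 0 1) (-(gaussianPDFReal 0 1 x * x)) x := by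
  rw [gaussianPDFReal_def]
  have h : HasDerivAt (fun x : ℝ => -(x - 0) ^ 2 / (2 * ((1 : ℝ≥0) : ℝ))) (-x) x := by
    have := (((hasDerivAt_id x).sub_const 0).pow 2).neg.div_const (2 * ((1 : ℝ≥0) : ℝ))
    convert! this using 1
    simp
    ring
  convert! h.exp.const_mul ((√(2 * Real.pi * ((1 : ℝ≥0) : ℝ)))⁻¹) using 1
  ring

/-- The Gaussian isoperimetric identity `∫ y in (a, ∞), y dγ = φ a`. -/
lemma setIntegral_Ioi_id_gaussianReal (a : ℝ) :
    ∫ y in Set.Ioi a, y ∂gaussianReal 0 1 = gaussianPDFReal 0 1 a := by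
  have hid : Integrable (fun x => gaussianPDFReal 0 1 x * x) :=
    (integrable_gaussianReal_iff one_ne_zero).1
      ((memLp_id_gaussianReal' 1 ENNReal.one_ne_top).integrable le_rfl)
  have hlim : Filter.Tendsto (gaussianPDFReal 0 1) Filter.atTop (nhds 0) :=
    tendsto_zero_of_hasDerivAt_of_integrableOn_Ioi (a := 0)
      (fun x _ => hasDerivAt_gaussianPDFReal_zero_one x) hid.neg.integrableOn
      (integrable_gaussianPDFReal 0 1).integrableOn
  have h := integral_Ioi_of_hasDerivAt_of_tendsto' (a := a)
    (fun x _ => hasDerivAt_gaussianPDFReal_zero_one x) hid.neg.integrableOn hlim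
  rw [integral_neg, zero_sub, neg_inj] at h
  rw [← h, ← integral_indicator measurableSet_Ioi, ← integral_indicator measurableSet_Ioi,
    integral_gaussianReal_eq_integral_smul one_ne_zero]
  refine integral_congr_ae (.of_forall fun x => ?_)
  by_cases hx : a < x <;> simp [hx]

lemma integrable_exp_sq_div_four_gaussianReal :
    Integrable (fun x => Real.exp (x ^ 2 / 4)) (gaussianReal 0 1) := by
  rw [integrable_gaussianReal_iff one_ne_zero]
  refine ((integrable_exp_neg_mul_sq (b := 1 / 4) (by norm_num)).const_mul
    (√(2 * Real.pi * ((1 : ℝ≥0) : ℝ)))⁻¹).congr (.of_forall fun x => ?_)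
  simp only [gaussianPDFReal, mul_assoc]
  rw [← Real.exp_add]
  congr 3
  simp
  ring

/-- Division by the density `dν/dγ` brings `γ`-integrals of nonnegative functions
to `ν`-integrals. -/
lemma integrable_div_rnDeriv_and_integral_le {α : Type*} [MeasurableSpace α] {γ ν : Measure α}
    [SigmaFinite γ] [SigmaFinite ν] (hν : ν ≪ γ) {h : α → ℝ} (hh : Integrable h γ)
    (h0 : 0 ≤ h) :
    Integrable (fun x => h x / (ν.rnDeriv γ x).toReal) ν ∧
      ∫ x, h x / (ν.rnDeriv γ x).toReal ∂ν ≤ ∫ x, h x ∂γ := by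
  have hind : (fun x => (ν.rnDeriv γ x).toReal * (h x / (ν.rnDeriv γ x).toReal)) =
      {x | (ν.rnDeriv γ x).toReal ≠ 0}.indicator h := by
    ext x
    by_cases hx : (ν.rnDeriv γ x).toReal = 0
    · simp [hx]
    · rw [mul_div_cancel₀ _ hx, Set.indicator_of_mem (by exact hx)]
  have hmeas : MeasurableSet {x | (ν.rnDeriv γ x).toReal ≠ 0} :=
    ((Measure.measurable_rnDeriv ν γ).ennreal_toReal (measurableSet_singleton 0)).compl
  refine ⟨?_, ?_⟩
  · rw [← integrable_toReal_rnDeriv_mul_iff hν, hind]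
    exact hh.indicator hmeas
  · rw [← integral_toReal_rnDeriv_mul hν, hind]
    exact integral_mono (hh.indicator hmeas) hh (Set.indicator_le_self' fun x _ => h0 x)

/-- Finite relative entropy with respect to `N(0,1)` implies a finite second moment. -/
lemma integrable_sq_of_integrable_log_rnDeriv_gaussianReal {ν : Measure ℝ}
    [IsProbabilityMeasure ν] (hν : ν ≪ gaussianReal 0 1)
    (hint : Integrable (fun x => Real.log (ν.rnDeriv (gaussianReal 0 1) x).toReal) ν) :
    Integrable (fun x => x ^ 2) ν := by
  have hexp := (integrable_div_rnDeriv_and_integral_le hν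
    integrable_exp_sq_div_four_gaussianReal fun x => (Real.exp_pos _).le).1
  refine ((hint.add hexp).const_mul 4).mono' (by fun_prop) ?_
  filter_upwards [Measure.rnDeriv_pos hν, hν.ae_le (Measure.rnDeriv_ne_top ν _)] with x h0 htop
  have hf : 0 < (ν.rnDeriv (gaussianReal 0 1) x).toReal := ENNReal.toReal_pos h0.ne' htop
  have h := Real.add_one_le_exp
    (x ^ 2 / 4 - Real.log (ν.rnDeriv (gaussianReal 0 1) x).toReal)
  rw [Real.exp_sub, Real.exp_log hf] at h
  rw [Real.norm_of_nonneg (sq_nonneg x), Pi.add_apply]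
  linarith

/-- Talagrand's inequality on the line, realised by the monotone rearrangement. -/
lemma exists_transport_gaussianReal {ν : Measure ℝ}
    [IsProbabilityMeasure ν] (hν : ν ≪ gaussianReal 0 1)
    (hint : Integrable (fun x => Real.log (ν.rnDeriv (gaussianReal 0 1) x).toReal) ν) :
    ∃ T : ℝ → ℝ, Measurable T ∧ (gaussianReal 0 1).map T = ν ∧
      Integrable (fun y => (T y - y) ^ 2) (gaussianReal 0 1) ∧
      ∫ y, (T y - y) ^ 2 ∂gaussianReal 0 1 ≤
        2 * ∫ x, Real.log (ν.rnDeriv (gaussianReal 0 1) x).toReal ∂ν := by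
  set γ := gaussianReal 0 1 with hγ
  have : NullSingletonClass γ := nullSingletonClass_gaussianReal one_ne_zero
  have : NullSingletonClass ν := ⟨fun x => hν (measure_singleton x)⟩
  have : γ.IsOpenPosMeasure :=
    (gaussianReal_absolutelyContinuous' 0 one_ne_zero).isOpenPosMeasure
  obtain ⟨T, hTm, hTmap, hT⟩ := exists_monotone_rearrangement γ ν
  have hmp : MeasurePreserving T γ ν := ⟨hTm, hTmap⟩
  have hTsq : Integrable (fun y => T y ^ 2) γ :=
    hmp.integrable_comp_of_integrable
      (integrable_sq_of_integrable_log_rnDeriv_gaussianReal hν hint)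
  have hyL2 : MemLp (fun y : ℝ => y) 2 γ := memLp_id_gaussianReal' 2 (by simp)
  have hysq : Integrable (fun y : ℝ => y ^ 2) γ := hyL2.integrable_sq
  have hy : Integrable (fun y : ℝ => y) γ := hyL2.integrable (by norm_num)
  have hTL2 : MemLp T 2 γ := (memLp_two_iff_integrable_sq hTm.aestronglyMeasurable).2 hTsq
  have hyT : Integrable (fun y => y * T y) γ := hyL2.integrable_mul hTL2
  have hy0 : ∫ y, y ∂γ = 0 := integral_id_gaussianReal
  have hysq1 : ∫ y, y ^ 2 ∂γ = 1 := by
    have h := variance_fun_id_gaussianReal (μ := 0) (v := 1)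
    rw [variance_of_integral_eq_zero (by fun_prop) integral_id_gaussianReal] at h
    simpa using h
  set q : ℝ → ℝ := fun x => ∫ y in {y | x < T y}, y ∂γ with hq
  obtain ⟨hqint, hqeq⟩ := integrable_setIntegral_lt_and_integral_eq hTm hy hy0 hyT
  have hset (x : ℝ) : {y | x < T y} = {y | cdf ν x < cdf γ y} := by
    ext y; simpa using (hT x y).not
  have hq0 (x : ℝ) : 0 ≤ q x := by
    have hm : MeasurableSet {y | x < T y} := measurableSet_lt measurable_const hTm
    rcases le_or_gt (cdf γ 0) (cdf ν x) with h | h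
    · refine setIntegral_nonneg hm fun y hxy => ?_
      rw [hset] at hxy
      exact ((monotone_cdf γ).reflect_lt (h.trans_lt hxy)).le
    · have hcompl : ∫ y in {y | x < T y}ᶜ, y ∂γ ≤ 0 := by
        refine setIntegral_nonpos hm.compl fun y hxy => ?_
        rw [hset] at hxy
        exact ((monotone_cdf γ).reflect_lt ((not_lt.1 (show ¬ cdf ν x < cdf γ y from hxy)).trans_lt h)).le
      linarith [integral_add_compl hm hy]
  have hqT (y : ℝ) : q (T y) = gaussianPDFReal 0 1 y := by
    have : {z | T y < T z} = Set.Ioi y := by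
      ext z
      rw [hset]
      simp [cdf_monotone_rearrangement hT, (strictMono_cdf γ).lt_iff_lt]
    simp only [hq, this]
    exact setIntegral_Ioi_id_gaussianReal y
  have hφ (x : ℝ) : 0 < gaussianPDFReal 0 1 x := gaussianPDFReal_pos 0 1 x one_ne_zero
  have hφq : (fun x => gaussianPDFReal 0 1 x * (q x / gaussianPDFReal 0 1 x)) = q := by
    ext x; exact mul_div_cancel₀ _ (hφ x).ne'
  have hrint : Integrable (fun x => q x / gaussianPDFReal 0 1 x) γ := by
    rw [hγ, integrable_gaussianReal_iff one_ne_zero, hφq]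
    exact hqint
  have hreq : ∫ x, q x / gaussianPDFReal 0 1 x ∂γ = ∫ y, y * T y ∂γ := by
    rw [hγ, integral_gaussianReal_eq_integral_smul one_ne_zero]
    simp_rw [smul_eq_mul]
    rw [hφq]
    exact hqeq
  obtain ⟨hsint, hsle⟩ := integrable_div_rnDeriv_and_integral_le hν hrint
    fun x => div_nonneg (hq0 x) (hφ x).le
  set f : ℝ → ℝ := fun x => (ν.rnDeriv γ x).toReal with hf
  have hfpos : ∀ᵐ x ∂ν, 0 < f x := by
    filter_upwards [Measure.rnDeriv_pos hν, hν.ae_le (Measure.rnDeriv_ne_top ν _)] with x h0 htop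
    exact ENNReal.toReal_pos h0.ne' htop
  have hpt : ∀ᵐ y ∂γ, T y ^ 2 / 2 - y ^ 2 / 2 + 1 -
      q (T y) / gaussianPDFReal 0 1 (T y) / f (T y) ≤ Real.log (f (T y)) := by
    filter_upwards [hmp.quasiMeasurePreserving.ae hfpos] with y hfy
    have hratio : q (T y) / gaussianPDFReal 0 1 (T y) =
        Real.exp (T y ^ 2 / 2 - y ^ 2 / 2) := by
      rw [hqT, div_eq_iff (hφ _).ne']
      simp only [gaussianPDFReal]
      rw [mul_left_comm, ← Real.exp_add]
      congr 2
      simp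
      ring
    have h := Real.add_one_le_exp (T y ^ 2 / 2 - y ^ 2 / 2 - Real.log (f (T y)))
    rw [Real.exp_sub, Real.exp_log hfy, ← hratio] at h
    linarith
  have hlogT : Integrable (fun y => Real.log (f (T y))) γ :=
    hmp.integrable_comp_of_integrable hint
  have hsT : Integrable (fun y => q (T y) / gaussianPDFReal 0 1 (T y) / f (T y)) γ :=
    hmp.integrable_comp_of_integrable hsint
  have hcomp (g : ℝ → ℝ) (hg : Integrable g ν) : ∫ y, g (T y) ∂γ = ∫ x, g x ∂ν := by
    have hg' := hg.1
    rw [← hTmap] at hg'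
    conv_rhs => rw [← hTmap]
    rw [integral_map hTm.aemeasurable hg']
  have hlog_eq : ∫ y, Real.log (f (T y)) ∂γ = ∫ x, Real.log (f x) ∂ν := hcomp _ hint
  have hs_eq : ∫ y, q (T y) / gaussianPDFReal 0 1 (T y) / f (T y) ∂γ =
      ∫ x, q x / gaussianPDFReal 0 1 x / f x ∂ν := hcomp _ hsint
  have hsub : Integrable (fun y => T y ^ 2 / 2 - y ^ 2 / 2) γ :=
    (hTsq.div_const 2).sub (hysq.div_const 2)
  have hadd : Integrable (fun y => T y ^ 2 / 2 - y ^ 2 / 2 + 1) γ := hsub.add (integrable_const 1)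
  have hle := integral_mono_ae (hadd.sub hsT) hlogT hpt
  simp only [Pi.sub_apply] at hle
  rw [integral_sub hadd hsT, integral_add hsub (integrable_const 1),
    integral_sub (hTsq.div_const 2) (hysq.div_const 2), integral_div, integral_div, hysq1,
    hs_eq, hlog_eq] at hle
  have hexpand : (fun y => (T y - y) ^ 2) = fun y => T y ^ 2 - 2 * (y * T y) + y ^ 2 := by
    ext y; ring
  have hcross : Integrable (fun y => T y ^ 2 - 2 * (y * T y)) γ := hTsq.sub (hyT.const_mul 2)
  refine ⟨T, hTm, hTmap, (hTL2.sub hyL2).integrable_sq, ?_⟩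
  rw [hexpand, integral_add hcross hysq,
    integral_sub hTsq (hyT.const_mul 2), integral_const_mul, hysq1]
  simp only [integral_const, probReal_univ, smul_eq_mul] at hle
  linarith

/-- **The `ψ`-T₂ (Talagrand) transportation-cost inequality.**
If `ψ : E ≃ᵐ ℝ` and `μ` is a probability measure on `E` with `ψ⁎μ = N(0,1)`, then for
every probability measure `ν ≪ μ`,
`inf { ∫ |ψ(x) − ψ(y)|² dπ : π coupling of ν and μ } ≤ 2·D(ν‖μ)`. -/
theorem psi_T2_inequality
    {E : Type*} [MeasurableSpace E] (ψ : E ≃ᵐ ℝ)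
    (μ : Measure E) [IsProbabilityMeasure μ]
    (hgauss : μ.map ψ = gaussianReal 0 1) :
    ∀ ν : Measure E, IsProbabilityMeasure ν → ν ≪ μ →
      (⨅ (π : Measure (E × E)) (_ : IsProbabilityMeasure π)
          (_ : π.map Prod.fst = ν) (_ : π.map Prod.snd = μ),
        ∫⁻ p, ENNReal.ofReal (|ψ p.1 - ψ p.2| ^ 2) ∂π)
        ≤ 2 * klDiv ν μ := by
  intro ν hνp hνμ
  by_cases hint : Integrable (fun x => Real.log (ν.rnDeriv μ x).toReal) ν
  swap
  · simp [klDiv, hint]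
  rw [klDiv, if_pos ⟨hνμ, hint⟩]
  have := Measure.isProbabilityMeasure_map (μ := ν) ψ.measurable.aemeasurable
  have hac : ν.map ψ ≪ gaussianReal 0 1 := hgauss ▸ hνμ.map ψ.measurable
  have hrn : (fun x => Real.log ((ν.map ψ).rnDeriv (gaussianReal 0 1) (ψ x)).toReal)
      =ᵐ[ν] fun x => Real.log (ν.rnDeriv μ x).toReal := by
    filter_upwards [hνμ.ae_le (ψ.measurableEmbedding.rnDeriv_map ν μ)] with x hx
    rw [← hgauss, hx]
  obtain ⟨T, hTm, hTmap, hTint, hTle⟩ := exists_transport_gaussianReal hac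
    (ψ.measurableEmbedding.integrable_map_iff.2 (hint.congr hrn.symm))
  rw [ψ.measurableEmbedding.integral_map, integral_congr_ae hrn] at hTle
  have hP : Measurable fun y => (ψ.symm (T y), ψ.symm y) := by fun_prop
  have hsymm (ρ : Measure E) : (ρ.map ψ).map ψ.symm = ρ := by
    rw [Measure.map_map ψ.symm.measurable ψ.measurable]
    simp
  refine (iInf₂_le ((gaussianReal 0 1).map fun y => (ψ.symm (T y), ψ.symm y))
    (Measure.isProbabilityMeasure_map hP.aemeasurable)).trans ?_
  refine (iInf₂_le ?_ ?_).trans ?_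
  · rw [Measure.map_map measurable_fst hP, ← hsymm ν, ← hTmap,
      Measure.map_map ψ.symm.measurable hTm]
    rfl
  · rw [Measure.map_map measurable_snd hP, ← hsymm μ, hgauss]
    rfl
  · rw [lintegral_map (by fun_prop) hP]
    simp only [MeasurableEquiv.apply_symm_apply, sq_abs]
    rw [← ofReal_integral_eq_lintegral_ofReal hTint (.of_forall fun y => sq_nonneg _),
      ← ENNReal.ofReal_ofNat 2, ← ENNReal.ofReal_mul (by norm_num)]
    exact ENNReal.ofReal_le_ofReal hTle
end

section
/- Let E be a measurable space, μ a probability measure on E, n ≥ 1, and ψ : E → ℝⁿ a measurable map. Suppose μ satisfies the ψ-T₂ inequality with constant c > 0: for every probability measure ν absolutely continuous with respect to μ with D(ν‖μ) < ∞, there exists a coupling π of ν and μ with ∫ ‖ψ(x) − ψ(y)‖² dπ(x,y) ≤ c·D(ν‖μ). Then for every measurable μ-integrable f : E → ℝ that is ψ-Lipschitz with constant L > 0 (i.e. |f(x) − f(y)| ≤ L‖ψ(x) − ψ(y)‖ for all x, y ∈ E) and every t ≥ 0: μ({f ≥ ∫ f dμ + t}) ≤ exp(−t²/(c·L²)). The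 bound is independent of the dimension n. -/
open MeasureTheory
open scoped ENNReal NNReal Classical

open ProbabilityTheory

/-- The log-likelihood ratio of a conditioned measure is almost surely constant. -/
lemma log_rnDeriv_cond_ae_eq {E : Type*} [MeasurableSpace E] (μ : Measure E)
    [IsProbabilityMeasure μ] {A : Set E} (hA : MeasurableSet A) :
    (fun x => Real.log ((cond μ A).rnDeriv μ x).toReal)
      =ᵐ[cond μ A] fun _ => -Real.log (μ.real A) := by
  have hν : cond μ A = μ.withDensity (A.indicator fun _ => (μ A)⁻¹) := by
    rw [withDensity_indicator hA, withDensity_const]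
    rfl
  have hd : (cond μ A).rnDeriv μ =ᵐ[μ] A.indicator fun _ => (μ A)⁻¹ := by
    rw [hν]
    exact Measure.rnDeriv_withDensity μ (measurable_const.indicator hA)
  filter_upwards [(cond_absolutelyContinuous (μ := μ) (s := A)).ae_le hd,
    ae_cond_mem hA] with x hx hxA
  rw [hx, Set.indicator_of_mem hxA, ENNReal.toReal_inv, Real.log_inv]
  rfl

/-- The relative entropy of a conditioned measure is minus the log-probability of the event. -/
lemma klDiv_cond {E : Type*} [MeasurableSpace E] (μ : Measure E)
    [IsProbabilityMeasure μ] {A : Set E} (hA : MeasurableSet A) (h0 : μ A ≠ 0) :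
    klDiv (cond μ A) μ = ENNReal.ofReal (-Real.log (μ.real A)) := by
  have := cond_isProbabilityMeasure h0
  have hlog := log_rnDeriv_cond_ae_eq μ hA
  rw [klDiv, if_pos ⟨cond_absolutelyContinuous, (integrable_const _).congr hlog.symm⟩,
    integral_congr_ae hlog]
  simp

/-- If `X` has mean at least `t ≥ 0` and `X² ≤ Y`, then `Y` has mean at least `t²`. -/
lemma sq_le_integral_of_le_integral {Ω : Type*} [MeasurableSpace Ω] {P : Measure Ω}
    [IsProbabilityMeasure P] {X Y : Ω → ℝ} (hX : Integrable X P) (hY : Integrable Y P)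
    (hXY : ∀ ω, X ω ^ 2 ≤ Y ω) {t : ℝ} (ht : 0 ≤ t) (htX : t ≤ ∫ ω, X ω ∂P) :
    t ^ 2 ≤ ∫ ω, Y ω ∂P := by
  have h : ∫ ω, (2 * t * X ω - t ^ 2) ∂P ≤ ∫ ω, Y ω ∂P :=
    integral_mono ((hX.const_mul _).sub (integrable_const _)) hY fun ω => by
      nlinarith [sq_nonneg (X ω - t), hXY ω]
  rw [integral_sub (hX.const_mul _) (integrable_const _), integral_const_mul] at h
  simp only [integral_const, probReal_univ, one_smul] at h
  nlinarith

/-- **Dimension-free concentration from the `ψ`-T₂ inequality.**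
Let `ψ : E → ℝⁿ` be measurable and suppose the probability measure `μ` satisfies the
`ψ`-T₂ inequality with constant `c > 0`: every probability measure `ν ≪ μ` with
finite relative entropy admits a coupling `π` with `μ` such that
`∫ ‖ψ(x) − ψ(y)‖² dπ ≤ c·D(ν‖μ)`. Then every `μ`-integrable `ψ`-Lipschitz function
`f` with constant `L > 0` satisfies, for all `t ≥ 0`,
`μ(f ≥ ∫ f dμ + t) ≤ exp(−t²/(c·L²))`, a bound independent of the dimension `n`. -/
theorem dimension_free_concentration_from_psi_T2
    {E : Type*} [MeasurableSpace E] (μ : Measure E) [IsProbabilityMeasure μ]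
    (n : ℕ) (ψ : E → EuclideanSpace ℝ (Fin n)) (hψ : Measurable ψ)
    (c : ℝ) (hc : 0 < c)
    (hT2 : ∀ ν : Measure E, IsProbabilityMeasure ν → ν ≪ μ → klDiv ν μ ≠ ⊤ →
      ∃ π : Measure (E × E), IsProbabilityMeasure π ∧
        π.map Prod.fst = ν ∧ π.map Prod.snd = μ ∧
        ∫⁻ p, ENNReal.ofReal (‖ψ p.1 - ψ p.2‖ ^ 2) ∂π ≤ ENNReal.ofReal c * klDiv ν μ) :
    ∀ f : E → ℝ, Measurable f → Integrable f μ →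
      ∀ L : ℝ, 0 < L → (∀ x y : E, |f x - f y| ≤ L * ‖ψ x - ψ y‖) →
        ∀ t : ℝ, 0 ≤ t →
          μ {x : E | (∫ x', f x' ∂μ) + t ≤ f x}
            ≤ ENNReal.ofReal (Real.exp (-t ^ 2 / (c * L ^ 2))) := by
  intro f hf hfi L hL hLip t ht
  set m := ∫ x', f x' ∂μ with hm
  set A : Set E := {x | m + t ≤ f x} with hAdef
  have hA : MeasurableSet A := measurableSet_le measurable_const hf
  by_cases h0 : μ A = 0
  · simp [h0]
  have hprob : IsProbabilityMeasure (cond μ A) := cond_isProbabilityMeasure h0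
  have hkl := klDiv_cond μ hA h0
  obtain ⟨π, hπ, h1, h2, hcost⟩ := hT2 _ hprob cond_absolutelyContinuous
    (hkl ▸ ENNReal.ofReal_ne_top)
  have hpos : 0 < μ.real A := ENNReal.toReal_pos h0 (measure_ne_top μ A)
  have hD : 0 ≤ -Real.log (μ.real A) :=
    neg_nonneg.2 (Real.log_nonpos hpos.le measureReal_le_one)
  rw [hkl, ← ENNReal.ofReal_mul hc.le] at hcost
  have hNmeas : Measurable fun p : E × E => ‖ψ p.1 - ψ p.2‖ ^ 2 := by fun_prop
  have hN0 : 0 ≤ᵐ[π] fun p : E × E => ‖ψ p.1 - ψ p.2‖ ^ 2 := ae_of_all _ fun p => by positivity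
  have hNi : Integrable (fun p : E × E => ‖ψ p.1 - ψ p.2‖ ^ 2) π :=
    (lintegral_ofReal_ne_top_iff_integrable hNmeas.aestronglyMeasurable hN0).1
      (hcost.trans_lt ENNReal.ofReal_lt_top).ne
  rw [← ofReal_integral_eq_lintegral_ofReal hNi hN0,
    ENNReal.ofReal_le_ofReal_iff (by positivity)] at hcost
  have hfν : Integrable f (cond μ A) :=
    hfi.restrict.smul_measure (ENNReal.inv_ne_top.2 h0)
  have hmean : m + t ≤ ∫ x, f x ∂(cond μ A) := by
    have h := integral_mono_ae (integrable_const (m + t)) hfν (ae_cond_mem hA)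
    simpa using h
  have hi1 : Integrable (fun p : E × E => f p.1) π :=
    (h1 ▸ hfν : Integrable f (π.map Prod.fst)).comp_measurable measurable_fst
  have hi2 : Integrable (fun p : E × E => f p.2) π :=
    (h2.symm ▸ hfi : Integrable f (π.map Prod.snd)).comp_measurable measurable_snd
  have he1 : ∫ p, f p.1 ∂π = ∫ x, f x ∂(cond μ A) := by
    rw [← h1, integral_map measurable_fst.aemeasurable hf.aestronglyMeasurable]
  have he2 : ∫ p, f p.2 ∂π = m := by
    rw [hm, ← integral_map measurable_snd.aemeasurable hf.aestronglyMeasurable, h2]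
  have hsq := sq_le_integral_of_le_integral (hi1.sub hi2) (hNi.const_mul (L ^ 2))
    (fun p => by
      have h := pow_le_pow_left₀ (abs_nonneg _) (hLip p.1 p.2) 2
      rwa [sq_abs, mul_pow] at h) ht
    (by
      simp only [Pi.sub_apply]
      rw [integral_sub hi1 hi2, he1, he2]
      linarith)
  rw [integral_const_mul] at hsq
  have hlog : Real.log (μ.real A) ≤ -t ^ 2 / (c * L ^ 2) := by
    rw [le_div_iff₀ (by positivity)]
    nlinarith [mul_le_mul_of_nonneg_left hcost (sq_nonneg L)]
  rw [← ofReal_measureReal (measure_ne_top μ A)]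
  exact ENNReal.ofReal_le_ofReal ((Real.log_le_iff_le_exp hpos).1 hlog)
end
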